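/- The Riemann hypothesis holds if and only if Li(ψ(x)) − π(x) > 0 for all sufficiently large real x, where ψ is the second Chebyshev function, π is the prime counting function, and Li(y) = ∫₂^y dt / log t is the offset logarithmic integral. -/

import Mathlib

open Filter

/-- The second Chebyshev function ψ(x) = Σ_{n ≤ x} Λ(n). -/
noncomputable def chebyshevPsi (x : ℝ) : ℝ :=
  ∑ n ∈ Finset.Icc 1 ⌊x⌋₊, ArithmeticFunction.vonMangoldt n

/-- The prime counting function π(x), the number of primes ≤ x. -/
noncomputable def primePi (x : ℝ) : ℕ := Nat.primeCounting ⌊x⌋₊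

/-- The offset logarithmic integral Li(y) = ∫₂^y dt / log t. -/
noncomputable def Li (y : ℝ) : ℝ := ∫ t in (2 : ℝ)..y, 1 / Real.log t

section

open MeasureTheory Set Topology

/-- The Mellin-type transform `s ↦ ∫_1^∞ f(t) t^(-s-1) dt`. -/
noncomputable def tailMellin (f : ℝ → ℂ) (s : ℂ) : ℂ :=
  ∫ t in Ioi (1 : ℝ), f t * (t : ℂ) ^ (-(s + 1))

lemma tailMellin_eq_mellin (f : ℝ → ℂ) (s : ℂ) :
    tailMellin f s = mellin ((Ioi (1 : ℝ)).indicator f) (-s) := by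
  have h : ∀ t : ℝ, (t : ℂ) ^ (-s - 1) • (Ioi (1 : ℝ)).indicator f t =
      (Ioi (1 : ℝ)).indicator (fun t : ℝ ↦ f t * (t : ℂ) ^ (-(s + 1))) t := by
    intro t
    by_cases ht : t ∈ Ioi (1 : ℝ)
    · simp only [indicator_of_mem ht, smul_eq_mul]; rw [mul_comm]; congr 2; ring
    · simp [indicator_of_notMem ht]
  rw [mellin, tailMellin]
  simp_rw [h]
  rw [setIntegral_indicator measurableSet_Ioi]
  congr 2
  ext x; simp only [mem_inter_iff, mem_Ioi]; constructor
  · intro hx; exact ⟨by linarith, hx⟩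
  · exact fun hx ↦ hx.2

lemma norm_cpow_neg_add_one {t : ℝ} (ht : 0 < t) (s : ℂ) :
    ‖(t : ℂ) ^ (-(s + 1))‖ = t ^ (-(s.re + 1)) := by
  rw [Complex.norm_cpow_eq_rpow_re_of_pos ht]; simp

lemma integrableOn_tailMellin {f : ℝ → ℂ} (hf : Measurable f) {C a : ℝ} {s : ℂ}
    (hC : ∀ t > 1, ‖f t‖ ≤ C * t ^ a) (hs : a < s.re) :
    IntegrableOn (fun t : ℝ ↦ f t * (t : ℂ) ^ (-(s + 1))) (Ioi 1) := by
  have h1 : IntegrableOn (fun t : ℝ ↦ C * t ^ (a - s.re - 1)) (Ioi 1) :=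
    (integrableOn_Ioi_rpow_of_lt (by linarith) one_pos).const_mul _
  refine Integrable.mono' h1 ?_ ?_
  · refine hf.aestronglyMeasurable.restrict.mul ?_
    refine (Measurable.aestronglyMeasurable ?_).restrict
    fun_prop
  · filter_upwards [ae_restrict_mem measurableSet_Ioi] with t ht
    have ht0 : 0 < t := lt_trans one_pos ht
    rw [norm_mul, norm_cpow_neg_add_one ht0]
    calc _ ≤ C * t ^ a * t ^ (-(s.re + 1)) := by gcongr; exact hC t ht
      _ = _ := by rw [mul_assoc, ← Real.rpow_add ht0]; congr 2; ring

lemma hasDerivAt_tailMellin {f : ℝ → ℂ} (hf : Measurable f) {C a : ℝ} {s : ℂ}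
    (hC : ∀ t > 1, ‖f t‖ ≤ C * t ^ a) (hs : a < s.re) :
    HasDerivAt (tailMellin f) (tailMellin (fun t ↦ -Real.log t * f t) s) s := by
  set F := (Ioi (1 : ℝ)).indicator f with hF
  have hFm : Measurable F := hf.indicator measurableSet_Ioi
  have hFb : ∀ t > 0, ‖F t‖ ≤ |C| * t ^ a := by
    intro t ht
    by_cases h : t ∈ Ioi (1 : ℝ)
    · rw [hF, indicator_of_mem h]
      exact (hC t h).trans (by gcongr; exact le_abs_self C)
    · rw [hF, indicator_of_notMem h, norm_zero]; positivity
  have hloc : LocallyIntegrableOn F (Ioi 0) := by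
    have : LocallyIntegrableOn (fun t : ℝ ↦ |C| * t ^ a) (Ioi 0) := by
      refine ContinuousOn.locallyIntegrableOn ?_ measurableSet_Ioi
      refine continuousOn_const.mul (continuousOn_id.rpow_const ?_)
      intro x hx; left; exact (ne_of_gt hx)
    rw [locallyIntegrableOn_iff isLocallyClosed_Ioi] at this ⊢
    intro k hk hkc
    refine (this k hk hkc).mono' hFm.aestronglyMeasurable.restrict ?_
    filter_upwards [ae_restrict_mem hkc.measurableSet] with t ht
    exact hFb t (hk ht)
  have htop : F =O[atTop] fun x : ℝ ↦ x ^ (-(-a)) := by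
    refine Asymptotics.IsBigO.of_bound |C| ?_
    filter_upwards [eventually_gt_atTop 0] with t ht
    rw [neg_neg, Real.norm_of_nonneg (Real.rpow_nonneg ht.le a)]
    exact hFb t ht
  have hzero : F =O[𝓝[>] 0] fun x : ℝ ↦ x ^ (-(-s.re - 1)) := by
    refine Asymptotics.IsBigO.of_bound 0 ?_
    filter_upwards [mem_nhdsWithin_of_mem_nhds (Iio_mem_nhds (one_pos : (0:ℝ) < 1))] with t ht
    rw [hF, indicator_of_notMem (by simpa using le_of_lt ht)]; simp
  have h := (mellin_hasDerivAt_of_isBigO_rpow (s := -s) hloc htop (by simpa using hs)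
    hzero (by simp)).2
  have h2 := h.comp s (hasDerivAt_neg s)
  convert! h2 using 1
  · ext z; simp [tailMellin_eq_mellin, hF]
  · rw [tailMellin_eq_mellin]
    have : (Ioi (1 : ℝ)).indicator (fun t : ℝ ↦ -(Real.log t : ℂ) * f t) =
        fun t ↦ (-1 : ℂ) • (Real.log t • F t) := by
      ext t
      by_cases h : t ∈ Ioi (1 : ℝ)
      · simp [hF, indicator_of_mem h]
      · simp [hF, indicator_of_notMem h]
    rw [this, mellin_const_smul]
    simp [mul_comm]

/-- Integration by parts for `tailMellin`, in the form given by Fubini's theorem. -/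
lemma mul_tailMellin_integral {g : ℝ → ℂ} (hg : Measurable g) {C a : ℝ} {s : ℂ}
    (hC : ∀ t > 1, ‖g t‖ ≤ C * t ^ a) (hs : a + 1 < s.re) (hs0 : 0 < s.re) :
    s * tailMellin (fun x ↦ ∫ t in Ioc 1 x, g t) s = tailMellin (fun t ↦ t * g t) s := by
  have hs1 : s ≠ 0 := by rintro rfl; simp at hs0
  let k : ℝ → ℝ → ℂ := fun x t ↦
    (Ioo 1 x).indicator (fun t ↦ g t * (x : ℂ) ^ (-(s + 1))) t
  have hgi : IntegrableOn (fun t : ℝ ↦ (t * ‖g t‖) * t ^ (-(s.re + 1))) (Ioi 1) := by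
    have h := integrableOn_tailMellin (f := fun t ↦ t * g t) (by fun_prop) (C := C) (a := a + 1)
      (s := s) ?_ hs
    · refine IntegrableOn.congr_fun
        (f := fun t : ℝ ↦ ‖(t : ℂ) * g t * (t : ℂ) ^ (-(s + 1))‖) h.norm ?_ measurableSet_Ioi
      intro t ht
      have ht0 : 0 < t := lt_trans one_pos ht
      simp only [norm_mul]
      rw [norm_cpow_neg_add_one ht0, Complex.norm_of_nonneg ht0.le]
    · intro t ht
      have ht0 : 0 < t := lt_trans one_pos ht
      rw [norm_mul, Complex.norm_of_nonneg ht0.le, Real.rpow_add_one ht0.ne']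
      nlinarith [hC t ht]
  have hkm : Measurable (Function.uncurry k) := by
    have : Function.uncurry k = {p : ℝ × ℝ | 1 < p.2 ∧ p.2 < p.1}.indicator
        (fun p ↦ g p.2 * (p.1 : ℂ) ^ (-(s + 1))) := by
      ext ⟨x, t⟩
      simp only [Function.uncurry, k, indicator, mem_Ioo, mem_ofPred_eq]
    rw [this]
    refine Measurable.indicator ?_ ?_
    · exact (hg.comp measurable_snd).mul (by fun_prop)
    · exact (measurableSet_lt measurable_const measurable_snd).inter
        (measurableSet_lt measurable_snd measurable_fst)
  have hpow : ∀ t > (1:ℝ), IntegrableOn (fun x : ℝ ↦ (x : ℂ) ^ (-(s + 1))) (Ioi t) := by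
    intro t ht
    exact integrableOn_Ioi_cpow_of_lt (by simp [hs0]) (by linarith)
  have hk1 : ∀ t > (1 : ℝ), ∀ x, k x t =
      (Ioi t).indicator (fun x : ℝ ↦ g t * (x : ℂ) ^ (-(s + 1))) x := by
    intro t ht x
    simp only [k, indicator, mem_Ioo, mem_Ioi]
    simp [show (1:ℝ) < t from ht]
  have hsub : ∀ t > (1:ℝ), Ioi (1:ℝ) ∩ Ioi t = Ioi t := by
    intro t ht; ext x; simp; intro h; linarith
  have hint : Integrable (Function.uncurry k)
      ((volume.restrict (Ioi (1:ℝ))).prod (volume.restrict (Ioi (1:ℝ)))) := by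
    rw [integrable_prod_iff' hkm.aestronglyMeasurable]
    constructor
    · filter_upwards [ae_restrict_mem measurableSet_Ioi] with t ht
      simp only [Function.uncurry]
      simp_rw [hk1 t ht]
      rw [integrable_indicator_iff measurableSet_Ioi]
      have : IntegrableOn (fun x : ℝ ↦ g t * (x : ℂ) ^ (-(s + 1))) (Ioi t) :=
        (hpow t ht).const_mul _
      rwa [IntegrableOn, Measure.restrict_restrict measurableSet_Ioi, inter_comm, hsub t ht]
    · refine (hgi.const_mul (1 / s.re)).congr ?_
      filter_upwards [ae_restrict_mem measurableSet_Ioi] with t ht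
      have ht0 : 0 < t := lt_trans one_pos ht
      simp only [Function.uncurry]
      simp_rw [hk1 t ht, norm_indicator_eq_indicator_norm]
      rw [setIntegral_indicator measurableSet_Ioi, hsub t ht]
      have : ∀ x ∈ Ioi t, ‖g t * (x:ℂ) ^ (-(s + 1))‖ = ‖g t‖ * x ^ (-(s.re + 1)) := by
        intro x hx
        rw [norm_mul, norm_cpow_neg_add_one (ht0.trans hx)]
      rw [setIntegral_congr_fun measurableSet_Ioi this, integral_const_mul,
        integral_Ioi_rpow_of_lt (by linarith) ht0]
      rw [show -(s.re + 1) = -s.re + -1 by ring, Real.rpow_add ht0, Real.rpow_neg_one,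
        show -s.re + -1 + 1 = -s.re by ring]
      field_simp
  have hswap := integral_integral_swap hint
  have hL : ∫ x in Ioi (1:ℝ), ∫ t in Ioi (1:ℝ), k x t =
      tailMellin (fun x ↦ ∫ t in Ioc 1 x, g t) s := by
    refine setIntegral_congr_fun measurableSet_Ioi ?_
    intro x hx
    simp only [k]
    rw [setIntegral_indicator measurableSet_Ioo, integral_mul_const, integral_Ioc_eq_integral_Ioo]
    congr 3
    ext y; simp +contextual
  have hR : ∫ t in Ioi (1:ℝ), ∫ x in Ioi (1:ℝ), k x t =
      (1 / s) * tailMellin (fun t ↦ t * g t) s := by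
    rw [tailMellin, ← integral_const_mul]
    refine setIntegral_congr_fun measurableSet_Ioi ?_
    intro t ht
    have ht0 : 0 < t := lt_trans one_pos ht
    have ht1 : (t : ℂ) ≠ 0 := by exact_mod_cast ht0.ne'
    simp only
    simp_rw [hk1 t ht]
    rw [setIntegral_indicator measurableSet_Ioi, hsub t ht, integral_const_mul,
      integral_Ioi_cpow_of_lt (by simp [hs0]) ht0]
    rw [show -(s + 1) + 1 = -s by ring, show -(s + 1) = -s - 1 by ring, Complex.cpow_sub _ _ ht1,
      Complex.cpow_one]
    field_simp
  rw [← hL, hswap, hR]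
  field_simp

/-- The entire function `(s - 1) ζ(s)`. -/
noncomputable def regZeta : ℂ → ℂ := Function.update (fun s ↦ (s - 1) * riemannZeta s) 1 1

lemma regZeta_one : regZeta 1 = 1 := by simp [regZeta]

lemma regZeta_of_ne {s : ℂ} (hs : s ≠ 1) : regZeta s = (s - 1) * riemannZeta s := by
  simp [regZeta, hs]

lemma differentiable_regZeta : Differentiable ℂ regZeta := by
  rw [← differentiableOn_univ,
    ← Complex.differentiableOn_compl_singleton_and_continuousAt_iff (c := 1) univ_mem]
  constructor
  · intro s hs
    have hs1 : s ≠ 1 := by simpa using hs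
    refine DifferentiableAt.differentiableWithinAt ?_
    have : regZeta =ᶠ[𝓝 s] fun s ↦ (s - 1) * riemannZeta s := by
      filter_upwards [isOpen_ne.mem_nhds hs1] with z hz using regZeta_of_ne hz
    rw [this.differentiableAt_iff]
    exact ((differentiableAt_id).sub_const 1).mul (differentiableAt_riemannZeta hs1)
  · rw [regZeta, continuousAt_update_same]
    exact riemannZeta_residue_one

/-- `∫_1^∞ {t} t^(-s-1) dt`. -/
noncomputable def fractMellin : ℂ → ℂ := tailMellin (fun t ↦ ((Int.fract t : ℝ) : ℂ))

lemma norm_fract_le (t : ℝ) : ‖((Int.fract t : ℝ) : ℂ)‖ ≤ 1 := by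
  rw [Complex.norm_of_nonneg (Int.fract_nonneg t)]; exact (Int.fract_lt_one t).le

lemma measurable_ofReal_fract : Measurable (fun t : ℝ ↦ ((Int.fract t : ℝ) : ℂ)) :=
  Complex.measurable_ofReal.comp measurable_fract

lemma differentiableAt_fractMellin {s : ℂ} (hs : 0 < s.re) : DifferentiableAt ℂ fractMellin s :=
  (hasDerivAt_tailMellin measurable_ofReal_fract (C := 1) (a := 0)
    (fun t _ ↦ by simpa using norm_fract_le t) hs).differentiableAt

lemma norm_fractMellin_le {s : ℂ} (hs : 0 < s.re) : ‖fractMellin s‖ ≤ 1 / s.re := by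
  calc ‖fractMellin s‖ ≤ ∫ t in Ioi (1 : ℝ), t ^ (-(s.re + 1)) := by
        refine norm_integral_le_of_norm_le (integrableOn_Ioi_rpow_of_lt (by linarith) one_pos) ?_
        filter_upwards [ae_restrict_mem measurableSet_Ioi] with t ht
        have ht0 : 0 < t := lt_trans one_pos ht
        rw [norm_mul, norm_cpow_neg_add_one ht0]
        exact mul_le_of_le_one_left (by positivity) (norm_fract_le t)
    _ = 1 / s.re := by
        rw [integral_Ioi_rpow_of_lt (by linarith) one_pos]
        simp

lemma tailMellin_id {s : ℂ} (hs : 1 < s.re) : tailMellin (fun t ↦ (t : ℂ)) s = 1 / (s - 1) := by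
  have h : tailMellin (fun t ↦ (t : ℂ)) s = ∫ t in Ioi (1:ℝ), (t : ℂ) ^ (-s) := by
    refine setIntegral_congr_fun measurableSet_Ioi fun t ht ↦ ?_
    have ht1 : (t : ℂ) ≠ 0 := by exact_mod_cast (lt_trans one_pos ht).ne'
    simp only
    rw [show -(s + 1) = -s - 1 by ring, Complex.cpow_sub _ _ ht1, Complex.cpow_one]
    field_simp
  rw [h, integral_Ioi_cpow_of_lt (by simpa using hs) one_pos]
  rw [show -s + 1 = -(s - 1) by ring]
  simp
  rw [← neg_sub s 1, neg_div_neg_eq, one_div]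

lemma riemannZeta_eq_sub_fractMellin {s : ℂ} (hs : 1 < s.re) :
    riemannZeta s = s * (1 / (s - 1) - fractMellin s) := by
  have hO : (fun n : ℕ ↦ ∑ k ∈ Finset.Icc 1 n, ((1 : ℕ → ℂ) k)) =O[atTop]
      fun n : ℕ ↦ (n : ℝ) ^ (1 : ℝ) := by
    refine Asymptotics.IsBigO.of_bound 1 (Eventually.of_forall fun n ↦ ?_)
    simp
  rw [← LSeries_one_eq_riemannZeta hs, LSeries_eq_mul_integral 1 zero_le_one hs
    (LSeriesSummable_one_iff.mpr hs) hO, ← tailMellin_id hs]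
  congr 1
  rw [fractMellin, tailMellin, tailMellin, ← integral_sub]
  · refine setIntegral_congr_fun measurableSet_Ioi fun t ht ↦ ?_
    have ht0 : 0 ≤ t := (lt_trans one_pos ht).le
    simp only [Pi.one_apply, Finset.sum_const, Nat.card_Icc, ← sub_mul]
    congr 1
    have h1 : ((⌊t⌋₊ : ℝ)) = t - Int.fract t := by
      rw [Int.self_sub_fract, natCast_floor_eq_intCast_floor ht0]
    simp only [add_tsub_cancel_right, nsmul_eq_mul, mul_one]
    rw [← Complex.ofReal_sub, ← h1]; simp
  · exact integrableOn_tailMellin (by fun_prop) (C := 1) (a := 1)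
      (fun t ht ↦ by simp [abs_of_pos (lt_trans one_pos ht)]) hs
  · exact integrableOn_tailMellin measurable_ofReal_fract (C := 1) (a := 0)
      (fun t _ ↦ by simpa using norm_fract_le t) (by linarith)

lemma regZeta_eq {s : ℂ} (hs : 0 < s.re) : regZeta s = s - s * (s - 1) * fractMellin s := by
  have hopen : IsOpen {s : ℂ | 0 < s.re} := isOpen_lt continuous_const Complex.continuous_re
  have hF : AnalyticOnNhd ℂ (fun s ↦ s - s * (s - 1) * fractMellin s) {s : ℂ | 0 < s.re} := by
    refine DifferentiableOn.analyticOnNhd (fun z hz ↦ ?_) hopen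
    have := differentiableAt_fractMellin hz
    exact DifferentiableAt.differentiableWithinAt (by fun_prop)
  refine AnalyticOnNhd.eqOn_of_preconnected_of_eventuallyEq
    (differentiable_regZeta.differentiableOn.analyticOnNhd hopen)
    hF (convex_halfSpace_re_gt 0).isPreconnected (z₀ := 2) (by simp) ?_ hs
  have : {s : ℂ | 1 < s.re} ∈ 𝓝 (2 : ℂ) :=
    (isOpen_lt continuous_const Complex.continuous_re).mem_nhds (by simp)
  filter_upwards [this] with z hz
  have hz1 : z ≠ 1 := by rintro rfl; simp at hz
  have : z - 1 ≠ 0 := sub_ne_zero.mpr hz1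
  rw [regZeta_of_ne hz1, riemannZeta_eq_sub_fractMellin hz]
  field_simp

lemma norm_regZeta_le {s : ℂ} (hs : 1 / 10 ≤ s.re) : ‖regZeta s‖ ≤ 11 * (1 + ‖s‖) ^ 2 := by
  have h0 : 0 < s.re := by linarith
  rw [regZeta_eq h0]
  have h1 : ‖fractMellin s‖ ≤ 10 :=
    (norm_fractMellin_le h0).trans (by rw [div_le_iff₀ h0]; linarith)
  have h2 : ‖s - 1‖ ≤ ‖s‖ + 1 := by simpa using norm_sub_le s 1
  have h3 : ‖s * (s - 1) * fractMellin s‖ ≤ ‖s‖ * (‖s‖ + 1) * 10 := by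
    rw [norm_mul, norm_mul]; gcongr
  have := norm_sub_le s (s * (s - 1) * fractMellin s)
  nlinarith [norm_nonneg s]

lemma fractMellin_ofReal_nonneg (x : ℝ) : 0 ≤ (fractMellin x).re := by
  have : fractMellin x = ((∫ t in Ioi (1 : ℝ), Int.fract t * t ^ (-(x + 1)) : ℝ) : ℂ) := by
    rw [fractMellin, tailMellin, ← integral_complex_ofReal]
    refine setIntegral_congr_fun measurableSet_Ioi fun t ht ↦ ?_
    have ht0 : 0 ≤ t := (lt_trans one_pos ht).le
    rw [Complex.ofReal_mul, Complex.ofReal_cpow ht0]; simp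
  rw [this, Complex.ofReal_re]
  refine setIntegral_nonneg measurableSet_Ioi fun t ht ↦ ?_
  have ht0 : 0 ≤ t := (lt_trans one_pos ht).le
  exact mul_nonneg (Int.fract_nonneg t) (by positivity)

lemma regZeta_ne_zero_of_one_le_re {s : ℂ} (hs : 1 ≤ s.re) : regZeta s ≠ 0 := by
  by_cases h : s = 1
  · rw [h, regZeta_one]; exact one_ne_zero
  · rw [regZeta_of_ne h]
    exact mul_ne_zero (sub_ne_zero.mpr h) (riemannZeta_ne_zero_of_one_le_re hs)

lemma regZeta_ofReal_ne_zero {x : ℝ} (hx : 0 < x) : regZeta x ≠ 0 := by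
  rcases le_or_gt 1 x with h | h
  · exact regZeta_ne_zero_of_one_le_re (by simpa using h)
  · intro h0
    have h1 := congrArg Complex.re (regZeta_eq (s := x) (by simpa using hx))
    have h2 : (x - (x : ℂ) * (x - 1) * fractMellin x).re =
        x - x * (x - 1) * (fractMellin x).re := by
      rw [← Complex.ofReal_one, ← Complex.ofReal_sub, ← Complex.ofReal_mul, Complex.sub_re,
        Complex.re_ofReal_mul, Complex.ofReal_re]
    rw [h0, h2, Complex.zero_re] at h1
    nlinarith [mul_nonneg (mul_nonneg hx.le (sub_nonneg.mpr h.le)) (fractMellin_ofReal_nonneg x)]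

lemma exists_norm_regZeta_two_add_ge :
    ∃ c > 0, ∀ t : ℝ, c ≤ ‖regZeta (2 + t * Complex.I)‖ := by
  set M : ℝ := ∑' n : ℕ, ‖LSeries.term (fun n ↦ (ArithmeticFunction.moebius n : ℂ)) 2 n‖ with hM
  have key : ∀ t : ℝ, 1 ≤ ‖riemannZeta (2 + t * Complex.I)‖ * (M + 1) := by
    intro t
    set s : ℂ := 2 + t * Complex.I with hs
    have hsre : s.re = 2 := by simp [hs]
    have h1 := ArithmeticFunction.LSeries_zeta_mul_Lseries_moebius (s := s) (by rw [hsre]; norm_num)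
    rw [ArithmeticFunction.LSeries_zeta_eq_riemannZeta (by rw [hsre]; norm_num)] at h1
    have h2 : ‖LSeries (fun n ↦ (ArithmeticFunction.moebius n : ℂ)) s‖ ≤ M := by
      have hn : ∀ n, ‖LSeries.term (fun n ↦ (ArithmeticFunction.moebius n : ℂ)) s n‖ =
        ‖LSeries.term (fun n ↦ (ArithmeticFunction.moebius n : ℂ)) 2 n‖ := by
        intro n; rw [LSeries.norm_term_eq, LSeries.norm_term_eq, hsre]; simp
      have hsum := (ArithmeticFunction.LSeriesSummable_moebius_iff (s := s)).mpr
        (by rw [hsre]; norm_num)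
      rw [hM]
      simp_rw [← hn]
      exact norm_tsum_le_tsum_norm hsum.norm
    calc (1 : ℝ) = ‖riemannZeta s * LSeries (fun n ↦ (ArithmeticFunction.moebius n : ℂ)) s‖ := by
          rw [h1, norm_one]
      _ ≤ _ := by rw [norm_mul]; gcongr; linarith
  have hM0 : 0 ≤ M := tsum_nonneg fun n ↦ norm_nonneg _
  refine ⟨1 / (M + 1), by positivity, fun t ↦ ?_⟩
  have hne : (2 + t * Complex.I) ≠ 1 := by
    intro h; have := congrArg Complex.re h; norm_num at this
  rw [regZeta_of_ne hne, norm_mul, div_le_iff₀ (by positivity)]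
  have h3 : 1 ≤ ‖2 + t * Complex.I - 1‖ := by
    have := Complex.abs_re_le_norm (2 + t * Complex.I - 1)
    norm_num at this ⊢; exact this
  calc (1:ℝ) ≤ 1 * (‖riemannZeta (2 + t * Complex.I)‖ * (M + 1)) := by simpa using key t
    _ ≤ ‖2 + t * Complex.I - 1‖ * (‖riemannZeta (2 + t * Complex.I)‖ * (M + 1)) := by
      gcongr
    _ = _ := by ring

/-- The error term `ψ(t) - t + 1` in the prime number theorem. -/
noncomputable def psiErr (t : ℝ) : ℝ := Chebyshev.psi t - t + 1

lemma measurable_psiErr : Measurable psiErr :=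
  (Chebyshev.psi_mono.measurable.sub measurable_id).add_const 1

lemma log_four_le : Real.log 4 ≤ 2 := by
  rw [show (4:ℝ) = 2 ^ 2 by norm_num, Real.log_pow]
  have := Real.log_two_lt_d9
  push_cast; linarith

lemma psi_le_six_mul {t : ℝ} (ht : 0 ≤ t) : Chebyshev.psi t ≤ 6 * t :=
  (Chebyshev.psi_le_const_mul_self ht).trans (by nlinarith [log_four_le])

lemma abs_psiErr_le {t : ℝ} (ht : 1 ≤ t) : |psiErr t| ≤ 6 * t := by
  have h1 := psi_le_six_mul (t := t) (by linarith)
  have h2 := Chebyshev.psi_nonneg t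
  rw [abs_le, psiErr]; constructor <;> linarith

lemma norm_psiErr_le {t : ℝ} (ht : 1 < t) : ‖(psiErr t : ℂ)‖ ≤ 6 * t ^ (1 : ℝ) := by
  rw [Complex.norm_real, Real.rpow_one]; exact abs_psiErr_le ht.le

lemma measurable_ofReal_psiErr : Measurable (fun t ↦ (psiErr t : ℂ)) :=
  Complex.measurable_ofReal.comp measurable_psiErr

lemma tailMellin_one {s : ℂ} (hs : 0 < s.re) : tailMellin (fun _ ↦ 1) s = 1 / s := by
  rw [tailMellin]
  simp_rw [one_mul]
  rw [integral_Ioi_cpow_of_lt (by simp [hs]) one_pos]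
  rw [show -(s + 1) + 1 = -s by ring]
  simp

lemma tailMellin_psi {s : ℂ} (hs : 1 < s.re) :
    s * tailMellin (fun t ↦ (Chebyshev.psi t : ℂ)) s = -(deriv riemannZeta s / riemannZeta s) := by
  have hIcc : ∀ n : ℕ, ∑ k ∈ Finset.Icc 1 n, ArithmeticFunction.vonMangoldt k =
      Chebyshev.psi n := by
    intro n; rw [Chebyshev.psi, Nat.floor_natCast]; rfl
  rw [← neg_div, ← ArithmeticFunction.LSeries_vonMangoldt_eq_deriv_riemannZeta_div hs,
    LSeries_eq_mul_integral_of_nonneg _ zero_le_one hs ?_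
      (fun n ↦ ArithmeticFunction.vonMangoldt_nonneg)]
  · congr 1
    refine setIntegral_congr_fun measurableSet_Ioi fun t ht ↦ ?_
    simp only
    rw [Chebyshev.psi_eq_psi_coe_floor, ← hIcc]
    push_cast; rfl
  · refine Asymptotics.IsBigO.of_bound 6 (Eventually.of_forall fun n ↦ ?_)
    rw [hIcc, Real.norm_of_nonneg (Chebyshev.psi_nonneg _)]
    simpa using psi_le_six_mul (t := n) (by positivity)

lemma deriv_regZeta_div {s : ℂ} (hs : 1 < s.re) :
    deriv regZeta s / regZeta s = 1 / (s - 1) + deriv riemannZeta s / riemannZeta s := by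
  have hs1 : s ≠ 1 := by rintro rfl; simp at hs
  have hz := riemannZeta_ne_zero_of_one_le_re hs.le
  have hsub : s - 1 ≠ 0 := sub_ne_zero.mpr hs1
  have h : regZeta =ᶠ[𝓝 s] fun s ↦ (s - 1) * riemannZeta s := by
    filter_upwards [isOpen_ne.mem_nhds hs1] with z hz using regZeta_of_ne hz
  have hd := ((hasDerivAt_id s).sub_const 1).mul (differentiableAt_riemannZeta hs1).hasDerivAt
  rw [regZeta_of_ne hs1, h.deriv_eq]
  rw [show deriv (fun s ↦ (s - 1) * riemannZeta s) s = _ from hd.deriv]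
  simp only [id]
  field_simp

lemma tailMellin_psiErr {s : ℂ} (hs : 1 < s.re) :
    tailMellin (fun t ↦ (psiErr t : ℂ)) s = -(1 / s) * (deriv regZeta s / regZeta s) := by
  have hs0 : s ≠ 0 := by rintro rfl; norm_num at hs
  have hs1 : s - 1 ≠ 0 := by
    rw [sub_ne_zero]; rintro rfl; norm_num at hs
  have hi1 := integrableOn_tailMellin (f := fun t ↦ (Chebyshev.psi t : ℂ)) (C := 6) (a := 1)
    (Complex.measurable_ofReal.comp Chebyshev.psi_mono.measurable) (fun t ht ↦ by
      rw [Complex.norm_real, Real.norm_of_nonneg (Chebyshev.psi_nonneg _), Real.rpow_one]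
      exact psi_le_six_mul (by linarith)) hs
  have hi2 := integrableOn_tailMellin (f := fun t ↦ (t : ℂ)) (by fun_prop) (C := 1) (a := 1)
      (fun t ht ↦ by simp [abs_of_pos (lt_trans one_pos ht)]) hs
  have hi3 := integrableOn_tailMellin (f := fun _ ↦ (1 : ℂ)) (by fun_prop) (C := 1) (a := 0)
      (s := s) (fun t ht ↦ by simp) (by linarith)
  have h : tailMellin (fun t ↦ (psiErr t : ℂ)) s =
      tailMellin (fun t ↦ (Chebyshev.psi t : ℂ)) s - tailMellin (fun t ↦ (t : ℂ)) s
        + tailMellin (fun _ ↦ 1) s := by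
    simp only [tailMellin]
    have hi12 : IntegrableOn (fun t : ℝ ↦ (Chebyshev.psi t : ℂ) * (t : ℂ) ^ (-(s + 1)) -
      t * (t : ℂ) ^ (-(s + 1))) (Ioi 1) := hi1.sub hi2
    rw [← integral_sub hi1 hi2, ← integral_add hi12 hi3]
    refine setIntegral_congr_fun measurableSet_Ioi fun t ht ↦ ?_
    simp only [psiErr]
    push_cast; ring
  have h1 : tailMellin (fun t ↦ (Chebyshev.psi t : ℂ)) s =
      -(1 / s) * (deriv riemannZeta s / riemannZeta s) := by
    rw [neg_mul, one_div_mul_eq_div, ← neg_div, eq_div_iff hs0, mul_comm, tailMellin_psi hs]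
  rw [h, h1, tailMellin_id hs, tailMellin_one (by linarith), deriv_regZeta_div hs]
  field_simp
  ring

/-- A bound for the logarithmic derivative of a zero-free function on a disc, from the
Borel–Carathéodory theorem. -/
lemma norm_deriv_div_le_of_ne_zero {f : ℂ → ℂ} (hf : Differentiable ℂ f) {M r r₁ : ℝ}
    (hr₁ : 0 < r₁) (hr : r₁ < r) (hM : ∀ z ∈ Metric.ball 0 r, ‖f z‖ ≤ M)
    (hne : ∀ z ∈ Metric.ball 0 r, f z ≠ 0) {z : ℂ} (hz : ‖z‖ ≤ r₁) :
    ‖deriv f z / f z‖ ≤ 8 * r / (r - r₁) ^ 2 * (Real.log (M / ‖f 0‖) + 1) := by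
  have hr0 : 0 < r := hr₁.trans hr
  have h0mem : (0:ℂ) ∈ Metric.ball (0:ℂ) r := Metric.mem_ball_self hr0
  have hf0 : f 0 ≠ 0 := hne 0 h0mem
  have hf0' : 0 < ‖f 0‖ := norm_pos_iff.mpr hf0
  set L := Real.log (M / ‖f 0‖) with hL
  have hM0 : 0 < M := hf0'.trans_le (hM 0 h0mem)
  have hL0 : 0 ≤ L := Real.log_nonneg (by rw [one_le_div hf0']; exact hM 0 h0mem)
  have hfd : Differentiable ℂ (deriv f) :=
    fun w ↦ (hf.analyticAt w).deriv.differentiableAt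
  have hd : DifferentiableOn ℂ (fun w ↦ deriv f w / f w) (Metric.ball 0 r) :=
    hfd.differentiableOn.div hf.differentiableOn hne
  obtain ⟨h, h00, hh⟩ := hd.isExactOn_ball.with_val_at 0 0
  have hconst : ∀ w ∈ Metric.ball (0:ℂ) r, f w * Complex.exp (-h w) = f 0 := by
    intro w hw
    have key : ∀ w ∈ Metric.ball (0:ℂ) r,
        HasDerivAt (fun w ↦ f w * Complex.exp (-h w)) 0 w := by
      intro w hw
      have := (hf w).hasDerivAt.mul ((hh w hw).neg.cexp)
      convert! this using 1
      have := hne w hw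
      field_simp
      ring
    have := Metric.isOpen_ball.is_const_of_deriv_eq_zero (convex_ball (0:ℂ) r).isPreconnected
      (fun w hw ↦ (key w hw).differentiableAt.differentiableWithinAt)
      (fun w hw ↦ (key w hw).deriv) hw h0mem
    simpa [h00] using this
  have hre : MapsTo h (Metric.ball 0 r) {z | z.re ≤ L + 1} := by
    intro w hw
    have h1 : ‖f w‖ = ‖f 0‖ * Real.exp (h w).re := by
      rw [← hconst w hw, norm_mul, Complex.norm_exp, mul_assoc, ← Real.exp_add]; simp
    have h2 : Real.exp (h w).re ≤ M / ‖f 0‖ := by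
      rw [le_div_iff₀ hf0', mul_comm, ← h1]; exact hM w hw
    have h3 : (h w).re ≤ L := by rwa [hL, Real.le_log_iff_exp_le (by positivity)]
    simp only [mem_ofPred_eq]; linarith
  have hhd : DifferentiableOn ℂ h (Metric.ball 0 r) :=
    fun w hw ↦ (hh w hw).differentiableAt.differentiableWithinAt
  have hrr : 0 < r - r₁ := by linarith
  have hball : ∀ w ∈ Metric.closedBall z ((r - r₁) / 2), ‖w‖ ≤ (r + r₁) / 2 := by
    intro w hw
    rw [Metric.mem_closedBall, dist_eq_norm] at hw
    have := norm_add_le (w - z) z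
    rw [sub_add_cancel] at this; linarith
  have hC : ∀ w ∈ Metric.sphere z ((r - r₁) / 2), ‖h w‖ ≤ 4 * r * (L + 1) / (r - r₁) := by
    intro w hw
    have hw1 := hball w (Metric.sphere_subset_closedBall hw)
    refine (Complex.borelCaratheodory_zero (by linarith) hhd hre hr0
      (by rw [mem_ball_zero_iff]; linarith) h00).trans ?_
    calc _ ≤ 2 * (L + 1) * r / ((r - r₁) / 2) := by gcongr <;> linarith
      _ = _ := by field_simp; ring
  have hsub : Metric.closedBall z ((r - r₁) / 2) ⊆ Metric.ball 0 r := by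
    intro w hw; rw [mem_ball_zero_iff]; linarith [hball w hw]
  have := Complex.norm_deriv_le_of_forall_mem_sphere_norm_le (half_pos hrr)
    ((hhd.mono hsub).diffContOnCl_ball Subset.rfl) hC
  have hzb : z ∈ Metric.ball (0:ℂ) r := by rw [mem_ball_zero_iff]; linarith
  rw [(hh z hzb).deriv] at this
  refine this.trans (le_of_eq ?_)
  field_simp
  ring

/-- Dividing out a zero of `f` by means of a Blaschke factor. -/
lemma exists_div_blaschke {f : ℂ → ℂ} (hf : Differentiable ℂ f) {M R : ℝ} (hR : 0 < R)
    (hM : ∀ z ∈ Metric.closedBall 0 R, ‖f z‖ ≤ M) {ρ : ℂ} (hρ : ‖ρ‖ < R) (hfρ : f ρ = 0) :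
    ∃ g : ℂ → ℂ, Differentiable ℂ g ∧ (∀ z ∈ Metric.closedBall 0 R, ‖g z‖ ≤ M) ∧
      ∀ z, R * (z - ρ) * g z = f z * (R ^ 2 - starRingEnd ℂ ρ * z) := by
  have hq : Differentiable ℂ (dslope f ρ) := by
    rw [← differentiableOn_univ, Complex.differentiableOn_dslope univ_mem]
    exact hf.differentiableOn
  have hR' : (R : ℂ) ≠ 0 := by exact_mod_cast hR.ne'
  have hg : Differentiable ℂ fun z ↦ dslope f ρ z * (R ^ 2 - starRingEnd ℂ ρ * z) / R := by fun_prop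
  have heq : ∀ z, R * (z - ρ) * (dslope f ρ z * (R ^ 2 - starRingEnd ℂ ρ * z) / R) =
      f z * (R ^ 2 - starRingEnd ℂ ρ * z) := by
    intro z
    have h1 := sub_smul_dslope f ρ z
    rw [hfρ, sub_zero, smul_eq_mul] at h1
    rw [← h1]; field_simp
  refine ⟨_, hg, ?_, heq⟩
  intro z hz
  refine Complex.norm_le_of_forall_mem_frontier_norm_le Metric.isBounded_ball
    hg.diffContOnCl ?_ (U := Metric.ball 0 R) (by rwa [closure_ball _ hR.ne'])
  intro w hw
  rw [frontier_ball _ hR.ne', mem_sphere_zero_iff_norm] at hw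
  have h1 := congrArg norm (heq w)
  have h2 : ‖(R : ℂ) ^ 2 - starRingEnd ℂ ρ * w‖ = R * ‖w - ρ‖ := by
    have : (R : ℂ) ^ 2 - starRingEnd ℂ ρ * w = w * starRingEnd ℂ (w - ρ) := by
      rw [map_sub, mul_sub, Complex.mul_conj, Complex.normSq_eq_norm_sq, hw]; push_cast; ring
    rw [this, norm_mul, Complex.norm_conj, hw]
  rw [norm_mul, norm_mul, norm_mul, h2, Complex.norm_of_nonneg hR.le] at h1
  have h3 : 0 < ‖w - ρ‖ := by
    rw [norm_pos_iff, sub_ne_zero]; rintro rfl; linarith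
  have h4 := mul_left_cancel₀ (a := R * ‖w - ρ‖) (by positivity) (h1.trans (mul_comm _ _))
  rw [h4]
  exact hM w (by rw [mem_closedBall_zero_iff, hw])

/-- A local bound for the logarithmic derivative of `f` away from the zeros of `f`. -/
lemma norm_deriv_div_le {M R r r₁ δ : ℝ} (hr₁ : 0 < r₁) (hr : r₁ < r) (hR : r < R) (hδ : 0 < δ)
    {z : ℂ} (hz : ‖z‖ ≤ r₁) (N : ℕ) {f : ℂ → ℂ} (hf : Differentiable ℂ f)
    (hM : ∀ z ∈ Metric.closedBall 0 R, ‖f z‖ ≤ M) (hf0 : f 0 ≠ 0)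
    (hN : M * (r / R) ^ N < ‖f 0‖)
    (hdist : ∀ ρ ∈ Metric.ball 0 r, f ρ = 0 → δ ≤ ‖z - ρ‖) :
    ‖deriv f z / f z‖ ≤
      N * (1 / δ + 1 / (R - r)) + 8 * r / (r - r₁) ^ 2 * (Real.log (M / ‖f 0‖) + 1) := by
  have hr0 : 0 < r := hr₁.trans hr
  have hR0 : 0 < R := hr0.trans hR
  induction N generalizing f with
  | zero =>
    have := hM 0 (Metric.mem_closedBall_self hR0.le)
    simp only [pow_zero, mul_one] at hN; linarith
  | succ N ih =>
    by_cases hne : ∀ w ∈ Metric.ball 0 r, f w ≠ 0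
    · have h1 := norm_deriv_div_le_of_ne_zero hf hr₁ hr (fun w hw ↦ hM w
        (Metric.ball_subset_closedBall (Metric.ball_subset_ball hR.le hw))) hne hz
      have : 0 ≤ ((N + 1 : ℕ) : ℝ) * (1 / δ + 1 / (R - r)) := by
        have : 0 < R - r := by linarith
        positivity
      linarith
    · push Not at hne
      obtain ⟨ρ, hρ, hfρ⟩ := hne
      have hρr := mem_ball_zero_iff.mp hρ
      obtain ⟨g, hg, hgM, hgf⟩ := exists_div_blaschke hf hR0 hM (hρr.trans hR) hfρ
      have hden : ∀ w, ‖w‖ ≤ r → R * (R - r) ≤ ‖(R : ℂ) ^ 2 - starRingEnd ℂ ρ * w‖ := by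
        intro w hw
        have h1 := norm_sub_norm_le ((R : ℂ) ^ 2) (starRingEnd ℂ ρ * w)
        rw [norm_pow, Complex.norm_of_nonneg hR0.le, norm_mul, Complex.norm_conj] at h1
        have : ‖ρ‖ * ‖w‖ ≤ R * r := mul_le_mul (hρr.trans hR).le hw (norm_nonneg _) hR0.le
        nlinarith
      have hden0 : ∀ w, ‖w‖ ≤ r → (R : ℂ) ^ 2 - starRingEnd ℂ ρ * w ≠ 0 := by
        intro w hw
        rw [← norm_pos_iff]
        exact lt_of_lt_of_le (mul_pos hR0 (by linarith)) (hden w hw)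
      have hRC : (R : ℂ) ≠ 0 := by exact_mod_cast hR0.ne'
      have hg0 : ‖f 0‖ * R = ‖ρ‖ * ‖g 0‖ := by
        have := congrArg norm (hgf 0)
        simp only [zero_sub, norm_mul, norm_neg, mul_zero, sub_zero, norm_pow,
          Complex.norm_of_nonneg hR0.le] at this
        have h2 : R * (‖f 0‖ * R) = R * (‖ρ‖ * ‖g 0‖) := by linarith
        exact mul_left_cancel₀ hR0.ne' h2
      have hf0' : 0 < ‖f 0‖ := norm_pos_iff.mpr hf0
      have hg0' : ‖f 0‖ * R ≤ r * ‖g 0‖ := by rw [hg0]; gcongr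
      have hg0pos : 0 < ‖g 0‖ := by
        by_contra h
        have : ‖g 0‖ = 0 := le_antisymm (not_lt.mp h) (norm_nonneg _)
        rw [this] at hg0; nlinarith
      have hfg : ‖f 0‖ ≤ ‖g 0‖ := by nlinarith
      have hgz : ∀ w ∈ Metric.ball (0:ℂ) r, g w = 0 → f w = 0 := by
        intro w hw hgw
        have := hgf w
        rw [hgw, mul_zero, eq_comm, mul_eq_zero] at this
        exact this.resolve_right (hden0 w (mem_ball_zero_iff.mp hw).le)
      have ih' := ih hg hgM (norm_pos_iff.mp hg0pos) ?_ (fun w hw h ↦ hdist w hw (hgz w hw h))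
      · have hzr : ‖z‖ ≤ r := hz.trans hr.le
        have hzρ := hdist ρ hρ hfρ
        have hzρ0 : z - ρ ≠ 0 := norm_pos_iff.mp (hδ.trans_le hzρ)
        have hder : R * g z + R * (z - ρ) * deriv g z =
            deriv f z * (R ^ 2 - starRingEnd ℂ ρ * z) - f z * starRingEnd ℂ ρ := by
          have e1 : HasDerivAt (fun z ↦ R * (z - ρ) * g z)
              (R * g z + R * (z - ρ) * deriv g z) z := by
            have := (((hasDerivAt_id z).sub_const ρ).const_mul (R : ℂ)).mul (hg z).hasDerivAt
            convert! this using 1; simp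
          have e2 : HasDerivAt (fun z ↦ f z * (R ^ 2 - starRingEnd ℂ ρ * z))
              (deriv f z * (R ^ 2 - starRingEnd ℂ ρ * z) - f z * starRingEnd ℂ ρ) z := by
            have := (hf z).hasDerivAt.mul
              (((hasDerivAt_id z).const_mul (starRingEnd ℂ ρ)).const_sub ((R : ℂ) ^ 2))
            convert! this using 1; simp; ring
          rw [show (fun z ↦ R * (z - ρ) * g z) = fun z ↦ f z * (R ^ 2 - starRingEnd ℂ ρ * z) from
            funext hgf] at e1
          exact e1.unique e2
        have hfz : f z ≠ 0 := fun h ↦ by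
          have := hdist z (by rw [mem_ball_zero_iff]; linarith) h
          simp at this; linarith
        have hgz0 : g z ≠ 0 := fun h ↦ hfz (hgz z (by rw [mem_ball_zero_iff]; linarith) h)
        have hd0 := hden0 z hzr
        have hsplit : deriv f z / f z = deriv g z / g z +
            (1 / (z - ρ) + starRingEnd ℂ ρ / (R ^ 2 - starRingEnd ℂ ρ * z)) := by
          have hf' : f z = R * (z - ρ) * g z / (R ^ 2 - starRingEnd ℂ ρ * z) := by
            rw [eq_div_iff hd0, ← hgf]
          have hd' : deriv f z = (R * g z + R * (z - ρ) * deriv g z + f z * starRingEnd ℂ ρ) /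
              (R ^ 2 - starRingEnd ℂ ρ * z) := by
            rw [eq_div_iff hd0, hder]; ring
          rw [hd', add_div _ (f z * _), add_div, div_div, div_div]
          rw [mul_comm (_ - _) (f z), mul_div_mul_left _ _ hfz, ← hgf]
          field_simp
          ring
        rw [hsplit]
        have b1 : ‖1 / (z - ρ)‖ ≤ 1 / δ := by
          rw [norm_div, norm_one]; gcongr
        have b2 : ‖starRingEnd ℂ ρ / (R ^ 2 - starRingEnd ℂ ρ * z)‖ ≤ 1 / (R - r) := by
          rw [norm_div, Complex.norm_conj]
          have hp : 0 < R - r := by linarith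
          calc _ ≤ R / (R * (R - r)) := by
                gcongr
                · exact (hρr.trans hR).le
                · exact hden z hzr
            _ = _ := by field_simp
        have b3 : Real.log (M / ‖g 0‖) ≤ Real.log (M / ‖f 0‖) := by
          have hMpos : 0 < M := hf0'.trans_le (hM 0 (Metric.mem_closedBall_self hR0.le))
          gcongr
        have b4 : 8 * r / (r - r₁) ^ 2 * (Real.log (M / ‖g 0‖) + 1) ≤
            8 * r / (r - r₁) ^ 2 * (Real.log (M / ‖f 0‖) + 1) := by gcongr
        have b5 := norm_add_le (deriv g z / g z)
          (1 / (z - ρ) + starRingEnd ℂ ρ / (R ^ 2 - starRingEnd ℂ ρ * z))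
        have b6 := norm_add_le (1 / (z - ρ)) (starRingEnd ℂ ρ / (R ^ 2 - starRingEnd ℂ ρ * z))
        push_cast
        nlinarith
      · rw [pow_succ] at hN
        have : M * ((r / R) ^ N * (r / R)) * R = M * (r / R) ^ N * r := by field_simp
        have h2 : M * (r / R) ^ N * r < ‖g 0‖ * r := by
          rw [← this]; nlinarith
        exact lt_of_mul_lt_mul_right h2 hr0.le

/-- Under the Riemann hypothesis, the logarithmic derivative of `(s - 1) ζ(s)` is
`O(|y|^(1/2) / δ)` on the line `Re s = 1/2 + δ`. -/
lemma exists_norm_deriv_regZeta_div_le (hRH : ∀ s : ℂ, 1 / 2 < s.re → regZeta s ≠ 0) :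
    ∃ C > 0, ∀ δ : ℝ, 0 < δ → δ ≤ 1 → ∀ s : ℂ, s.re = 1 / 2 + δ →
      ‖deriv regZeta s / regZeta s‖ ≤ C * √(1 + |s.im|) / δ := by
  obtain ⟨c, hc, hcle⟩ := exists_norm_regZeta_two_add_ge
  set A := |Real.log (550 / c)| + 4 with hA
  set k := Real.log (19 / 16) with hk
  have hk0 : 0 < k := Real.log_pos (by norm_num)
  have hA0 : 0 < A := by positivity
  refine ⟨(A / k + 1) * 5 + 1280 * (A + 1), by positivity, fun δ hδ hδ1 s hs ↦ ?_⟩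
  set u := 1 + |s.im| with hu
  have hu1 : 1 ≤ u := by rw [hu]; linarith [abs_nonneg s.im]
  have hsu : 1 ≤ √u := Real.one_le_sqrt.mpr hu1
  set M := 275 * u ^ 2 with hM
  have hM0 : 0 < M := by positivity
  set w : ℂ := 2 + s.im * Complex.I with hw
  set f : ℂ → ℂ := fun z ↦ regZeta (w + z) with hf
  have hfd : Differentiable ℂ f := by
    intro z
    exact (differentiable_regZeta _).comp z (by fun_prop)
  have hwn : ‖w‖ ≤ 2 + |s.im| := by
    refine (norm_add_le _ _).trans ?_
    simp
  have hfM : ∀ z ∈ Metric.closedBall (0:ℂ) (19/10), ‖f z‖ ≤ M := by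
    intro z hz
    rw [mem_closedBall_zero_iff] at hz
    have h1 := abs_le.mp ((Complex.abs_re_le_norm z).trans hz)
    refine (norm_regZeta_le ?_).trans ?_
    · simp [hw]; linarith [h1.1]
    · have : 1 + ‖w + z‖ ≤ 5 * u := by
        have := norm_add_le w z
        rw [hu]; linarith [abs_nonneg s.im]
      calc 11 * (1 + ‖w + z‖) ^ 2 ≤ 11 * (5 * u) ^ 2 := by gcongr
        _ = _ := by rw [hM]; ring
  have hf0 : c ≤ ‖f 0‖ := by simpa [hf, hw] using hcle s.im
  have hlog : Real.log (2 * M / c) ≤ A * √u := by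
    have h1 : 2 * M / c = (550 / c) * u ^ 2 := by rw [hM]; ring
    rw [h1, Real.log_mul (by positivity) (by positivity), Real.log_pow]
    have h2 : Real.log u ≤ √u * 2 := by
      have := Real.log_le_rpow_div (x := u) (by linarith) (ε := 1 / 2) (by norm_num)
      rw [← Real.sqrt_eq_rpow] at this; linarith
    have h3 := le_abs_self (Real.log (550 / c))
    push_cast
    nlinarith [abs_nonneg (Real.log (550 / c))]
  set N := ⌈A * √u / k⌉₊ with hN
  have hN1 : A * √u / k ≤ N := Nat.le_ceil _
  have hN2 : (N : ℝ) ≤ A * √u / k + 1 := (Nat.ceil_lt_add_one (by positivity)).le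
  have hpow : M * ((16 / 10) / (19 / 10) : ℝ) ^ N < ‖f 0‖ := by
    have h1 : ((16 / 10) / (19 / 10) : ℝ) = Real.exp (-k) := by
      rw [hk, Real.exp_neg, Real.exp_log (by norm_num)]; norm_num
    rw [h1, ← Real.exp_nat_mul]
    have h2 : (N : ℝ) * -k ≤ -Real.log (2 * M / c) := by
      rw [div_le_iff₀ hk0] at hN1; linarith
    have h3 : Real.exp ((N : ℝ) * -k) ≤ c / (2 * M) := by
      refine (Real.exp_le_exp.mpr h2).trans ?_
      rw [Real.exp_neg, Real.exp_log (by positivity), inv_div]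
    calc M * Real.exp ((N : ℝ) * -k) ≤ M * (c / (2 * M)) := by gcongr
      _ = c / 2 := by field_simp
      _ < ‖f 0‖ := by linarith
  set z : ℂ := ((δ - 3 / 2 : ℝ) : ℂ) with hz
  have hwz : w + z = s := by
    apply Complex.ext
    · simp [hw, hz, hs]; ring
    · simp [hw, hz]
  have hzn : ‖z‖ ≤ 3 / 2 := by
    rw [hz, Complex.norm_real, Real.norm_eq_abs, abs_le]; constructor <;> linarith
  have hdist : ∀ ρ ∈ Metric.ball (0:ℂ) (16/10), f ρ = 0 → δ ≤ ‖z - ρ‖ := by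
    intro ρ _ hρ
    have h1 : (w + ρ).re ≤ 1 / 2 := by
      by_contra h; exact hRH _ (not_le.mp h) hρ
    have h2 := (le_abs_self _).trans (Complex.abs_re_le_norm (z - ρ))
    rw [Complex.sub_re, show z.re = δ - 3 / 2 by simp [hz]] at h2
    rw [Complex.add_re, show w.re = 2 by simp [hw]] at h1
    linarith
  have main := norm_deriv_div_le (r₁ := 3 / 2) (by norm_num) (by norm_num) (by norm_num)
    hδ hzn N hfd hfM (norm_pos_iff.mp (hc.trans_le hf0)) hpow hdist
  have hder : deriv f z = deriv regZeta s := by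
    rw [hf, deriv_comp_const_add, hwz]
  have hfz : f z = regZeta s := by rw [hf]; simp only [hwz]
  rw [hder, hfz] at main
  refine main.trans ?_
  have hf0p : 0 < ‖f 0‖ := hc.trans_le hf0
  have hlog2 : Real.log (M / ‖f 0‖) ≤ A * √u := by
    refine le_trans ?_ hlog
    apply Real.log_le_log (by positivity)
    rw [div_le_div_iff₀ hf0p hc]
    nlinarith
  have h5 : 1 / δ + 1 / ((19 / 10 : ℝ) - 16 / 10) ≤ 5 / δ := by
    rw [le_div_iff₀ hδ, add_mul, one_div_mul_cancel hδ.ne']; linarith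
  have h6 : (N : ℝ) ≤ (A / k + 1) * √u := by
    calc (N : ℝ) ≤ A * √u / k + 1 := hN2
      _ ≤ A * √u / k + √u := by gcongr
      _ = _ := by ring
  have h7 : Real.log (M / ‖f 0‖) + 1 ≤ (A + 1) * √u / δ := by
    calc _ ≤ (A + 1) * √u := by linarith
      _ ≤ _ := by rw [le_div_iff₀ hδ]; exact mul_le_of_le_one_right (by positivity) hδ1
  calc _ ≤ ((A / k + 1) * √u) * (5 / δ) + 1280 * ((A + 1) * √u / δ) := by
        refine add_le_add ?_ ?_
        · gcongr
        · have : (8 * (16 / 10) / (16 / 10 - 3 / 2) ^ 2 : ℝ) = 1280 := by norm_num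
          rw [this]; gcongr
    _ = _ := by ring

lemma integrable_one_add_abs_rpow : Integrable (fun y : ℝ ↦ (1 + |y|) ^ (-(3 / 2) : ℝ)) := by
  simpa using integrable_one_add_norm (E := ℝ) (μ := volume) (r := 3 / 2) (by norm_num)

lemma integrable_vertical {G : ℂ → ℂ} {a b σ : ℝ} (ha : a ≤ σ) (hb : σ ≤ b)
    (hG : DifferentiableOn ℂ G {s | a ≤ s.re ∧ s.re ≤ b}) {K : ℝ}
    (hK : ∀ s : ℂ, a ≤ s.re → s.re ≤ b → ‖G s‖ ≤ K * (1 + |s.im|) ^ (-(3 / 2) : ℝ)) :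
    Integrable fun y : ℝ ↦ G (σ + y * Complex.I) := by
  refine (integrable_one_add_abs_rpow.const_mul K).mono' ?_ ?_
  · refine Continuous.aestronglyMeasurable ?_
    exact hG.continuousOn.comp_continuous (by fun_prop) (fun y ↦ by simp [ha, hb])
  · filter_upwards with y
    simpa using hK (σ + y * Complex.I) (by simpa using ha) (by simpa using hb)

/-- Shifting a vertical line of integration. -/
lemma integral_vertical_eq {G : ℂ → ℂ} {a b : ℝ} (hab : a ≤ b)
    (hG : DifferentiableOn ℂ G {s | a ≤ s.re ∧ s.re ≤ b}) {K : ℝ}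
    (hK : ∀ s : ℂ, a ≤ s.re → s.re ≤ b → ‖G s‖ ≤ K * (1 + |s.im|) ^ (-(3 / 2) : ℝ)) :
    ∫ y : ℝ, G (a + y * Complex.I) = ∫ y : ℝ, G (b + y * Complex.I) := by
  have hrect : ∀ T : ℝ, (∫ x in a..b, G (x + (-T : ℝ) * Complex.I)) -
      (∫ x in a..b, G (x + T * Complex.I)) +
      Complex.I • (∫ y in (-T)..T, G (b + y * Complex.I)) -
      Complex.I • (∫ y in (-T)..T, G (a + y * Complex.I)) = 0 := by
    intro T
    have := Complex.integral_boundary_rect_eq_zero_of_differentiableOn G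
      (a + (-T : ℝ) * Complex.I) (b + T * Complex.I) (hG.mono ?_)
    · simpa using this
    · intro s hs
      have h1 := hs.1
      simp only [Complex.add_re, Complex.ofReal_re, Complex.re_ofReal_mul, Complex.I_re, mul_zero,
        add_zero, mem_preimage, uIcc_of_le hab] at h1
      exact h1
  have hz : Tendsto (fun T : ℝ ↦ K * (1 + |T|) ^ (-(3 / 2) : ℝ) * |b - a|) atTop (𝓝 0) := by
    have h1 : Tendsto (fun T : ℝ ↦ 1 + |T|) atTop atTop :=
      tendsto_atTop_add_const_left _ _ tendsto_abs_atTop_atTop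
    have h2 := ((tendsto_rpow_neg_atTop (y := 3 / 2) (by norm_num)).comp h1)
    simpa using (h2.const_mul K).mul_const |b - a|
  have hhor : ∀ ε : ℝ, |ε| = 1 →
      Tendsto (fun T : ℝ ↦ ∫ x in a..b, G (x + (ε * T : ℝ) * Complex.I)) atTop (𝓝 0) := by
    intro ε hε
    refine squeeze_zero_norm (fun T ↦ ?_) hz
    refine intervalIntegral.norm_integral_le_of_norm_le_const fun x hx ↦ ?_
    rw [uIoc_of_le hab] at hx
    have := hK (x + (ε * T : ℝ) * Complex.I) (by simpa using hx.1.le) (by simpa using hx.2)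
    have him : (x + (ε * T : ℝ) * Complex.I : ℂ).im = ε * T := by simp
    rwa [him, abs_mul, hε, one_mul] at this
  have hv : ∀ σ : ℝ, a ≤ σ → σ ≤ b → Tendsto (fun T : ℝ ↦ ∫ y in (-T)..T, G (σ + y * Complex.I))
      atTop (𝓝 (∫ y : ℝ, G (σ + y * Complex.I))) := fun σ h1 h2 ↦
    intervalIntegral_tendsto_integral (integrable_vertical h1 h2 hG hK)
      tendsto_neg_atTop_atBot tendsto_id
  have hlim := (((hhor (-1) (by simp)).sub (hhor 1 (by simp))).add
    ((hv b hab le_rfl).const_smul Complex.I)).sub ((hv a le_rfl hab).const_smul Complex.I)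
  have h0 := tendsto_nhds_unique hlim (tendsto_const_nhds (x := (0 : ℂ)).congr fun T ↦ by
    rw [neg_one_mul, one_mul]; exact (hrect T).symm)
  have h1 : Complex.I *
      ((∫ y : ℝ, G (b + y * Complex.I)) - ∫ y : ℝ, G (a + y * Complex.I)) = 0 := by
    rw [← h0]; simp only [smul_eq_mul]; ring
  exact (sub_eq_zero.mp ((mul_eq_zero.mp h1).resolve_left Complex.I_ne_zero)).symm

/-- The primitive `∫_1^x (ψ(t) - t + 1) dt`. -/
noncomputable def psiErrInt (x : ℝ) : ℝ := ∫ t in (1 : ℝ)..x, psiErr t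

lemma intervalIntegrable_psiErr (a b : ℝ) : IntervalIntegrable psiErr volume a b :=
  ((Chebyshev.psi_mono.intervalIntegrable).sub (continuous_id.intervalIntegrable a b)).add
    intervalIntegrable_const

lemma continuous_psiErrInt : Continuous psiErrInt :=
  intervalIntegral.continuous_primitive intervalIntegrable_psiErr 1

lemma integral_Ioc_ofReal_psiErr {x : ℝ} (hx : 1 ≤ x) :
    ∫ t in Ioc 1 x, (psiErr t : ℂ) = psiErrInt x := by
  rw [psiErrInt, intervalIntegral.integral_of_le hx]
  exact integral_ofReal

lemma abs_psiErrInt_le {x : ℝ} (hx : 1 ≤ x) : |psiErrInt x| ≤ 6 * x ^ (2 : ℝ) := by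
  have h := intervalIntegral.norm_integral_le_of_norm_le_const (a := 1) (b := x) (f := psiErr)
    (C := 6 * x) (fun t ht ↦ by
      rw [uIoc_of_le hx] at ht
      exact (abs_psiErr_le ht.1.le).trans (by linarith [ht.2]))
  rw [abs_of_nonneg (by linarith : (0:ℝ) ≤ x - 1)] at h
  rw [Real.rpow_two]
  refine h.trans ?_
  nlinarith

lemma tailMellin_psiErrInt {s : ℂ} (hs : 1 < s.re) :
    tailMellin (fun x ↦ (psiErrInt x : ℂ)) (s + 1) =
      -(deriv regZeta s / regZeta s) / (s * (s + 1)) := by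
  have hs0 : s ≠ 0 := by rintro rfl; norm_num at hs
  have hs1 : s + 1 ≠ 0 := by
    intro h; have := congrArg Complex.re h; simp at this; linarith
  have h1 := mul_tailMellin_integral measurable_ofReal_psiErr (s := s + 1)
    (fun t ht ↦ norm_psiErr_le ht) (by simp; linarith) (by simp; linarith)
  have h2 : tailMellin (fun x ↦ ∫ t in Ioc 1 x, (psiErr t : ℂ)) (s + 1) =
      tailMellin (fun x ↦ (psiErrInt x : ℂ)) (s + 1) := by
    refine setIntegral_congr_fun measurableSet_Ioi fun t ht ↦ ?_
    simp only [integral_Ioc_ofReal_psiErr (le_of_lt ht)]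
  have h3 : tailMellin (fun t ↦ (t : ℂ) * (psiErr t : ℂ)) (s + 1) =
      tailMellin (fun t ↦ (psiErr t : ℂ)) s := by
    refine setIntegral_congr_fun measurableSet_Ioi fun t ht ↦ ?_
    have ht1 : (t : ℂ) ≠ 0 := by exact_mod_cast (lt_trans one_pos ht).ne'
    simp only
    rw [show -(s + 1 + 1) = -(s + 1) - 1 by ring, Complex.cpow_sub _ _ ht1, Complex.cpow_one]
    field_simp
  rw [h2, h3, tailMellin_psiErr hs] at h1
  rw [eq_div_iff (mul_ne_zero hs0 hs1), mul_comm s, ← mul_assoc, mul_comm _ (s + 1), h1]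
  field_simp

lemma one_add_abs_im_le {s : ℂ} (hs : 1 / 2 ≤ s.re) : 1 + |s.im| ≤ 3 * ‖s‖ := by
  have h1 := (le_abs_self _).trans (Complex.abs_re_le_norm s)
  have h2 := Complex.abs_im_le_norm s
  linarith

/-- The Mellin transform of `psiErrInt`, in the variable `s` with `tailMellin _ (s + 1)`. -/
noncomputable def mellinPsiErrInt (s : ℂ) : ℂ := -(deriv regZeta s / regZeta s) / (s * (s + 1))

lemma exists_norm_mellinPsiErrInt_le (hRH : ∀ s : ℂ, 1 / 2 < s.re → regZeta s ≠ 0) :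
    ∃ C > 0, ∀ δ : ℝ, 0 < δ → δ ≤ 1 → ∀ s : ℂ, s.re = 1 / 2 + δ →
      ‖mellinPsiErrInt s‖ ≤ C / δ * (1 + |s.im|) ^ (-(3 / 2) : ℝ) := by
  obtain ⟨C, hC, h⟩ := exists_norm_deriv_regZeta_div_le hRH
  refine ⟨9 * C, by positivity, fun δ hδ hδ1 s hs ↦ ?_⟩
  have h1 := one_add_abs_im_le (s := s) (by linarith)
  have h2 := one_add_abs_im_le (s := s + 1) (by simp; linarith)
  simp only [Complex.add_im, Complex.one_im, add_zero] at h2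
  set u := 1 + |s.im| with hu
  have hu0 : 0 < u := by positivity
  rw [mellinPsiErrInt, norm_div, norm_neg, norm_mul]
  have hpow : u ^ (-(3 / 2) : ℝ) = √u / u ^ 2 := by
    rw [Real.sqrt_eq_rpow, ← Real.rpow_natCast u 2, ← Real.rpow_sub hu0]; norm_num
  rw [hpow]
  calc _ ≤ (C * √u / δ) / (u / 3 * (u / 3)) := by
        gcongr
        · exact h δ hδ hδ1 s hs
        · linarith
        · linarith
    _ = _ := by field_simp; norm_num

lemma differentiableAt_mellinPsiErrInt (hRH : ∀ s : ℂ, 1 / 2 < s.re → regZeta s ≠ 0) {s : ℂ}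
    (hs : 1 / 2 < s.re) : DifferentiableAt ℂ mellinPsiErrInt s := by
  have hs0 : s ≠ 0 := by rintro rfl; norm_num at hs
  have hs1 : s + 1 ≠ 0 := by
    intro h; have := congrArg Complex.re h; simp at this; linarith
  have hd : DifferentiableAt ℂ (deriv regZeta) s :=
    (differentiable_regZeta.analyticAt s).deriv.differentiableAt
  exact ((hd.div (differentiable_regZeta s) (hRH s hs)).neg).div (by fun_prop)
    (mul_ne_zero hs0 hs1)

/-- Mellin inversion for `psiErrInt`, under the Riemann hypothesis. -/
lemma psiErrInt_eq_integral (hRH : ∀ s : ℂ, 1 / 2 < s.re → regZeta s ≠ 0) {x : ℝ} (hx : 1 < x) :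
    (psiErrInt x : ℂ) = (1 / (2 * Real.pi)) • ∫ y : ℝ, (x : ℂ) ^ ((3 / 2 : ℝ) + y * Complex.I + 1) *
      mellinPsiErrInt ((3 / 2 : ℝ) + y * Complex.I) := by
  set F : ℝ → ℂ := (Ioi (1 : ℝ)).indicator (fun x ↦ (psiErrInt x : ℂ)) with hF
  have hm : ∀ y : ℝ, mellin F ((-(5 / 2) : ℝ) + y * Complex.I) =
      mellinPsiErrInt ((3 / 2 : ℝ) + (-y : ℝ) * Complex.I) := by
    intro y
    rw [mellinPsiErrInt, ← tailMellin_psiErrInt (by simp; norm_num), tailMellin_eq_mellin]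
    congr 1; push_cast; ring
  have hcont : Measurable (fun x ↦ (psiErrInt x : ℂ)) :=
    Complex.measurable_ofReal.comp continuous_psiErrInt.measurable
  have hconv : MellinConvergent F ((-(5 / 2) : ℝ) : ℂ) := by
    have h1 := integrableOn_tailMellin hcont (C := 6) (a := 2) (s := (5 / 2 : ℝ))
      (fun t ht ↦ by rw [Complex.norm_real]; exact abs_psiErrInt_le (le_of_lt ht))
      (by simp; norm_num)
    rw [← integrable_indicator_iff measurableSet_Ioi] at h1
    refine (h1.congr (Eventually.of_forall fun t ↦ ?_)).integrableOn
    by_cases ht : t ∈ Ioi (1 : ℝ)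
    · simp only [hF, indicator_of_mem ht, smul_eq_mul]
      rw [mul_comm]; congr 2; push_cast; ring
    · simp [hF, indicator_of_notMem ht]
  obtain ⟨C, hC, hbd⟩ := exists_norm_mellinPsiErrInt_le hRH
  have hint : Integrable fun y : ℝ ↦ mellinPsiErrInt ((3 / 2 : ℝ) + y * Complex.I) := by
    refine integrable_vertical (a := 3 / 2) (b := 3 / 2) le_rfl le_rfl (fun s hs ↦ ?_)
      (K := C / 1) (fun s h1 h2 ↦ ?_)
    · refine (differentiableAt_mellinPsiErrInt hRH ?_).differentiableWithinAt
      linarith [hs.1]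
    · exact hbd 1 one_pos le_rfl s (by linarith)
  have hvert : Complex.VerticalIntegrable (mellin F) (-(5 / 2)) := by
    rw [Complex.VerticalIntegrable]
    simp_rw [hm]
    exact hint.comp_neg
  have hat : ContinuousAt F x := by
    have : F =ᶠ[𝓝 x] fun x ↦ (psiErrInt x : ℂ) := by
      filter_upwards [Ioi_mem_nhds hx] with t ht
      rw [hF, indicator_of_mem (show t ∈ Ioi (1:ℝ) from ht)]
    rw [continuousAt_congr this]
    exact (Complex.continuous_ofReal.comp continuous_psiErrInt).continuousAt
  have h := mellinInv_mellin_eq (-(5 / 2)) F (lt_trans one_pos hx) hconv hvert hat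
  rw [hF, indicator_of_mem (show x ∈ Ioi (1:ℝ) from hx), ← hF] at h
  rw [← h, mellinInv]
  congr 1
  rw [← integral_neg_eq_self]
  refine integral_congr_ae (Eventually.of_forall fun y ↦ ?_)
  simp only [smul_eq_mul]
  rw [hm, neg_neg]
  congr 2; push_cast; ring

lemma countable_riemannZetaZeros : riemannZetaZeros.Countable := by
  have h : riemannZetaZeros ⊆ ⋃ n : ℕ, Metric.closedBall (0 : ℂ) n ∩ riemannZetaZeros := by
    intro z hz
    obtain ⟨n, hn⟩ := exists_nat_ge ‖z‖
    exact mem_iUnion.mpr ⟨n, by rwa [mem_closedBall_zero_iff], hz⟩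
  exact (countable_iUnion fun n ↦
    ((isCompact_closedBall _ _).inter_riemannZetaZeros_finite).countable).mono h

lemma ae_regZeta_half_ne_zero :
    ∀ᵐ y : ℝ, regZeta ((1 / 2 : ℝ) + y * Complex.I) ≠ 0 := by
  have hinj : Function.Injective fun y : ℝ ↦ ((1 / 2 : ℝ) : ℂ) + y * Complex.I := by
    intro a b hab; simpa using hab
  filter_upwards [(countable_riemannZetaZeros.preimage hinj).ae_notMem volume] with y hy h
  have h1 : ((1 / 2 : ℝ) : ℂ) + y * Complex.I ≠ 1 := by
    intro h; have := congrArg Complex.re h; norm_num at this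
  rw [regZeta_of_ne h1] at h
  exact hy (mem_riemannZetaZeros.mpr ((mul_eq_zero.mp h).resolve_left (sub_ne_zero.mpr h1)))

lemma tendsto_mul_integral_norm_mellinPsiErrInt (hRH : ∀ s : ℂ, 1 / 2 < s.re → regZeta s ≠ 0) :
    Tendsto (fun δ : ℝ ↦ ∫ y : ℝ, δ * ‖mellinPsiErrInt ((1 / 2 + δ : ℝ) + y * Complex.I)‖)
      (𝓝[>] 0) (𝓝 0) := by
  obtain ⟨C, hC, hbd⟩ := exists_norm_mellinPsiErrInt_le hRH
  have hsmall : ∀ᶠ δ : ℝ in 𝓝[>] 0, 0 < δ ∧ δ ≤ 1 := by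
    filter_upwards [Ioc_mem_nhdsGT (one_pos : (0:ℝ) < 1)] with δ hδ using hδ
  rw [show (0 : ℝ) = ∫ _ : ℝ, (0 : ℝ) by simp]
  refine tendsto_integral_filter_of_dominated_convergence
    (fun y ↦ C * (1 + |y|) ^ (-(3 / 2) : ℝ)) ?_ ?_ (integrable_one_add_abs_rpow.const_mul C) ?_
  · rw [integral_zero]
    filter_upwards [hsmall] with δ hδ
    refine Continuous.aestronglyMeasurable (continuous_const.mul (Continuous.norm ?_))
    rw [continuous_iff_continuousAt]
    intro y
    exact (differentiableAt_mellinPsiErrInt hRH (by simp; linarith)).continuousAt.comp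
      (f := fun y : ℝ ↦ ((1 / 2 + δ : ℝ) + y * Complex.I : ℂ)) (by fun_prop)
  · rw [integral_zero]
    filter_upwards [hsmall] with δ hδ
    filter_upwards with y
    have := hbd δ hδ.1 hδ.2 ((1 / 2 + δ : ℝ) + y * Complex.I) (by simp)
    rw [norm_mul, norm_norm, Real.norm_of_nonneg hδ.1.le]
    have him : ((1 / 2 + δ : ℝ) + y * Complex.I : ℂ).im = y := by simp
    rw [him] at this
    calc _ ≤ δ * (C / δ * (1 + |y|) ^ (-(3 / 2) : ℝ)) := by
          gcongr; exact hδ.1.le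
      _ = _ := by have := hδ.1.ne'; field_simp
  · filter_upwards [ae_regZeta_half_ne_zero] with y hy
    rw [integral_zero]
    set s : ℂ := (1 / 2 : ℝ) + y * Complex.I with hs
    have hsre : s.re = 1 / 2 := by simp [hs]
    have hs0 : s ≠ 0 := by intro h; rw [h] at hsre; norm_num at hsre
    have hs1 : s + 1 ≠ 0 := by
      intro h; have := congrArg Complex.re h; simp [hsre] at this; norm_num at this
    have hd : DifferentiableAt ℂ (deriv regZeta) s :=
      (differentiable_regZeta.analyticAt s).deriv.differentiableAt
    have hc : ContinuousAt mellinPsiErrInt s :=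
      (((hd.div (differentiable_regZeta s) hy).neg).div
        (by fun_prop : DifferentiableAt ℂ (fun s : ℂ ↦ s * (s + 1)) s)
        (mul_ne_zero hs0 hs1)).continuousAt
    have h0 : Tendsto (fun δ : ℝ ↦ ((1 / 2 + δ : ℝ) + y * Complex.I : ℂ)) (𝓝[>] 0) (𝓝 s) := by
      refine tendsto_nhdsWithin_of_tendsto_nhds ?_
      have : Continuous (fun δ : ℝ ↦ ((1 / 2 + δ : ℝ) + y * Complex.I : ℂ)) := by fun_prop
      convert this.tendsto 0 using 2
      simp [hs]
    have h1 := (hc.tendsto.comp h0).norm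
    have h2 : Tendsto (fun δ : ℝ ↦ δ) (𝓝[>] 0) (𝓝 0) :=
      tendsto_nhdsWithin_of_tendsto_nhds tendsto_id
    simpa using h2.mul h1

lemma abs_psiErrInt_le_integral (hRH : ∀ s : ℂ, 1 / 2 < s.re → regZeta s ≠ 0) {x : ℝ} (hx : 1 < x)
    {δ : ℝ} (hδ : 0 < δ) (hδ1 : δ ≤ 1) :
    |psiErrInt x| ≤ x ^ (3 / 2 + δ) *
      ∫ y : ℝ, ‖mellinPsiErrInt ((1 / 2 + δ : ℝ) + y * Complex.I)‖ := by
  have hx0 : 0 < x := lt_trans one_pos hx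
  have hxC : (x : ℂ) ≠ 0 := by exact_mod_cast hx0.ne'
  obtain ⟨C, hC, hbd⟩ := exists_norm_mellinPsiErrInt_le hRH
  have hshift := integral_vertical_eq (a := 1 / 2 + δ) (b := 3 / 2)
    (G := fun s ↦ (x : ℂ) ^ (s + 1) * mellinPsiErrInt s) (by linarith)
    (K := x ^ (5 / 2 : ℝ) * (C / δ)) (fun s hs ↦ ?_) (fun s h1 h2 ↦ ?_)
  · have hE := psiErrInt_eq_integral hRH hx
    rw [← hshift] at hE
    have h1 : |psiErrInt x| = ‖(psiErrInt x : ℂ)‖ := by rw [Complex.norm_real]; rfl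
    rw [h1, hE, norm_smul]
    have hpi : ‖1 / (2 * Real.pi)‖ ≤ 1 := by
      rw [Real.norm_of_nonneg (by positivity), div_le_one (by positivity)]
      linarith [Real.pi_gt_three]
    rw [← integral_const_mul]
    refine (mul_le_of_le_one_left (norm_nonneg _) hpi).trans ?_
    refine (norm_integral_le_integral_norm _).trans (le_of_eq ?_)
    congr 1; ext y
    rw [norm_mul, Complex.norm_cpow_eq_rpow_re_of_pos hx0]
    congr 2; simp; ring
  · have : DifferentiableAt ℂ mellinPsiErrInt s :=
      differentiableAt_mellinPsiErrInt hRH (by linarith [hs.1])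
    have h2 : DifferentiableAt ℂ (fun s : ℂ ↦ (x : ℂ) ^ (s + 1)) s :=
      (by fun_prop : DifferentiableAt ℂ (fun s : ℂ ↦ s + 1) s).const_cpow (Or.inl hxC)
    exact (h2.mul this).differentiableWithinAt
  · rw [norm_mul, Complex.norm_cpow_eq_rpow_re_of_pos hx0, mul_assoc]
    gcongr
    · exact hx.le
    · simp; linarith
    · refine (hbd (s.re - 1 / 2) (by linarith) (by linarith) s (by ring)).trans ?_
      gcongr; linarith

/-- Under the Riemann hypothesis, `∫_1^x (ψ(t) - t + 1) dt = o(x^(3/2) log x)`. -/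
lemma eventually_abs_psiErrInt_le (hRH : ∀ s : ℂ, 1 / 2 < s.re → regZeta s ≠ 0) {ε : ℝ}
    (hε : 0 < ε) : ∀ᶠ x : ℝ in atTop, |psiErrInt x| ≤ ε * x ^ (3 / 2 : ℝ) * Real.log x := by
  have hinv : Tendsto (fun x : ℝ ↦ (Real.log x)⁻¹) atTop (𝓝[>] 0) :=
    tendsto_inv_atTop_nhdsGT_zero.comp Real.tendsto_log_atTop
  have h := (tendsto_mul_integral_norm_mellinPsiErrInt hRH).comp hinv
  have h2 := h.eventually (gt_mem_nhds (show 0 < ε / Real.exp 1 by positivity))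
  filter_upwards [h2, eventually_gt_atTop (Real.exp 1)] with x hx hxe
  have hx1 : 1 < x := lt_trans (by simp) hxe
  have hx0 : 0 < x := lt_trans one_pos hx1
  have hlog : 1 < Real.log x := by rwa [Real.lt_log_iff_exp_lt hx0]
  have hl0 : 0 < Real.log x := by linarith
  have hb := abs_psiErrInt_le_integral hRH hx1 (inv_pos.mpr hl0) (inv_le_one_of_one_le₀ hlog.le)
  simp only [Function.comp, integral_const_mul] at hx
  have hpow : x ^ (3 / 2 + (Real.log x)⁻¹) = x ^ (3 / 2 : ℝ) * Real.exp 1 := by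
    rw [Real.rpow_add hx0]
    congr 1
    rw [Real.rpow_def_of_pos hx0, mul_inv_cancel₀ hl0.ne']
  rw [hpow] at hb
  refine hb.trans ?_
  set J := ∫ y : ℝ, ‖mellinPsiErrInt ((1 / 2 + (Real.log x)⁻¹ : ℝ) + y * Complex.I)‖ with hJ
  have hJ2 : Real.exp 1 * J ≤ ε * Real.log x := by
    rw [lt_div_iff₀ (by positivity)] at hx
    have : (Real.log x)⁻¹ * J * Real.exp 1 * Real.log x ≤ ε * Real.log x := by gcongr
    have h3 : (Real.log x)⁻¹ * J * Real.exp 1 * Real.log x = Real.exp 1 * J := by field_simp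
    linarith
  calc _ = x ^ (3 / 2 : ℝ) * (Real.exp 1 * J) := by ring
    _ ≤ x ^ (3 / 2 : ℝ) * (ε * Real.log x) := by gcongr
    _ = _ := by ring

/-- The weighted integral of the error term `ψ(t) - t + 1` that partial summation produces in
`π(x)`. -/
noncomputable def psiErrLogInt (x : ℝ) : ℝ := ∫ t in (2 : ℝ)..x, psiErr t / (t * Real.log t ^ 2)

/-- The contribution of the proper prime powers to `ψ(x) / log x + ∫_2^x ψ(t) / (t log² t) dt`. -/
noncomputable def psiSubThetaWeight (x : ℝ) : ℝ :=
  (Chebyshev.psi x - Chebyshev.theta x) / Real.log x +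
    ∫ t in (2 : ℝ)..x, (Chebyshev.psi t - Chebyshev.theta t) / (t * Real.log t ^ 2)

lemma pos_of_mem_uIcc {a b t : ℝ} (ha : 1 < a) (hb : 1 < b) (ht : t ∈ uIcc a b) : 1 < t :=
  (lt_min ha hb).trans_le ht.1

lemma continuousOn_one_div_mul_log_sq {a b : ℝ} (ha : 1 < a) (hb : 1 < b) :
    ContinuousOn (fun t : ℝ ↦ 1 / (t * Real.log t ^ 2)) (uIcc a b) := by
  intro t ht
  have h1 := pos_of_mem_uIcc ha hb ht
  have h2 := Real.log_pos h1
  have h3 : t ≠ 0 := by linarith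
  have : ContinuousAt (fun t : ℝ ↦ 1 / (t * Real.log t ^ 2)) t := by
    fun_prop (disch := positivity)
  exact this.continuousWithinAt

lemma intervalIntegrable_psiErr_div {a b : ℝ} (ha : 1 < a) (hb : 1 < b) :
    IntervalIntegrable (fun t ↦ psiErr t / (t * Real.log t ^ 2)) volume a b := by
  simpa [div_eq_mul_inv] using
    (intervalIntegrable_psiErr a b).mul_continuousOn (continuousOn_one_div_mul_log_sq ha hb)

lemma intervalIntegrable_psi_sub_theta_div {a b : ℝ} (ha : 1 < a) (hb : 1 < b) :
    IntervalIntegrable (fun t ↦ (Chebyshev.psi t - Chebyshev.theta t) / (t * Real.log t ^ 2))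
      volume a b := by
  simpa [div_eq_mul_inv] using
    ((Chebyshev.psi_mono.intervalIntegrable (a := a) (b := b)).sub
      Chebyshev.theta_mono.intervalIntegrable).mul_continuousOn
      (continuousOn_one_div_mul_log_sq ha hb)

lemma intervalIntegrable_inv_log {a b : ℝ} (ha : 1 < a) (hb : 1 < b) :
    IntervalIntegrable (fun t ↦ 1 / Real.log t) volume a b := by
  refine ContinuousOn.intervalIntegrable fun t ht ↦ ?_
  have h1 := pos_of_mem_uIcc ha hb ht
  have h2 := Real.log_pos h1
  have h3 : t ≠ 0 := by linarith
  have : ContinuousAt (fun t : ℝ ↦ 1 / Real.log t) t := by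
    fun_prop (disch := positivity)
  exact this.continuousWithinAt

lemma Li_eq {x : ℝ} (hx : 2 ≤ x) :
    Li x = x / Real.log x - 2 / Real.log 2 + ∫ t in (2 : ℝ)..x, 1 / Real.log t ^ 2 := by
  have h2 := intervalIntegrable_inv_log (a := 2) (b := x) (by norm_num) (by linarith)
  have h3 := Chebyshev.intervalIntegrable_one_div_log_sq (a := 2) (b := x) (by norm_num)
    (by linarith)
  have := intervalIntegral.integral_eq_sub_of_hasDerivAt (a := 2) (b := x)
    (f := fun t ↦ t / Real.log t) (f' := fun t ↦ 1 / Real.log t - 1 / Real.log t ^ 2) ?_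
    (h2.sub h3)
  · rw [intervalIntegral.integral_sub h2 h3] at this
    rw [Li]; linarith
  · intro t ht
    have h1 := pos_of_mem_uIcc (by norm_num) (by linarith) ht
    have h2 := Real.log_pos h1
    have h3 : t ≠ 0 := by linarith
    convert! (hasDerivAt_id t).div (Real.hasDerivAt_log h3) h2.ne' using 1
    simp; field_simp

lemma integral_one_div_mul_log_sq {x : ℝ} (hx : 2 ≤ x) :
    ∫ t in (2 : ℝ)..x, 1 / (t * Real.log t ^ 2) = 1 / Real.log 2 - 1 / Real.log x := by
  rw [intervalIntegral.integral_eq_sub_of_hasDerivAt (f := fun t ↦ -(Real.log t)⁻¹)]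
  · ring
  · intro t ht
    have h1 := pos_of_mem_uIcc (by norm_num) (by linarith) ht
    have h2 := Real.log_pos h1
    have h3 : t ≠ 0 := by linarith
    convert! ((Real.hasDerivAt_log h3).inv h2.ne').neg using 1
    field_simp
  · exact (continuousOn_one_div_mul_log_sq (by norm_num) (by linarith)).intervalIntegrable

lemma primeCounting_eq_Li_add {x : ℝ} (hx : 2 ≤ x) :
    (Nat.primeCounting ⌊x⌋₊ : ℝ) = Li x + psiErr x / Real.log x + psiErrLogInt x -
      psiSubThetaWeight x + 1 / Real.log 2 := by
  have h1 : (1 : ℝ) < 2 := by norm_num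
  have h1x : 1 < x := by linarith
  have i1 := intervalIntegrable_psiErr_div h1 h1x
  have i2 := intervalIntegrable_psi_sub_theta_div h1 h1x
  have i3 := Chebyshev.intervalIntegrable_one_div_log_sq h1 h1x
  have i4 := (continuousOn_one_div_mul_log_sq h1 h1x).intervalIntegrable (μ := volume)
  have key : ∫ t in (2 : ℝ)..x, Chebyshev.theta t / (t * Real.log t ^ 2) =
      psiErrLogInt x - (∫ t in (2 : ℝ)..x, (Chebyshev.psi t - Chebyshev.theta t) /
        (t * Real.log t ^ 2)) + (∫ t in (2 : ℝ)..x, 1 / Real.log t ^ 2) -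
        ∫ t in (2 : ℝ)..x, 1 / (t * Real.log t ^ 2) := by
    rw [psiErrLogInt, ← intervalIntegral.integral_sub i1 i2,
      ← intervalIntegral.integral_add (i1.sub i2) i3,
      ← intervalIntegral.integral_sub ((i1.sub i2).add i3) i4]
    refine intervalIntegral.integral_congr fun t ht ↦ ?_
    have h1 := pos_of_mem_uIcc h1 h1x ht
    have h2 := Real.log_pos h1
    have h3 : t ≠ 0 := by linarith
    simp only [psiErr]
    field_simp; ring
  rw [Chebyshev.primeCounting_eq_theta_div_log_add_integral hx, key, Li_eq hx,
    integral_one_div_mul_log_sq hx, psiSubThetaWeight, psiErr]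
  ring

lemma Li_sub_Li {x y : ℝ} (hx : 1 < x) (hy : 1 < y) :
    Li y - Li x - (y - x) / Real.log x =
      ∫ t in x..y, (1 / Real.log t - 1 / Real.log x) := by
  have h2 : (1 : ℝ) < 2 := by norm_num
  rw [intervalIntegral.integral_sub (intervalIntegrable_inv_log hx hy) (by simp),
    Li, Li, intervalIntegral.integral_interval_sub_left (intervalIntegrable_inv_log h2 hy)
    (intervalIntegrable_inv_log h2 hx)]
  simp; ring

lemma Li_le_add {x y : ℝ} (hx : 1 < x) (hy : 1 < y) :
    Li y ≤ Li x + (y - x) / Real.log x := by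
  have hi : ∀ {a b}, 1 < a → 1 < b → IntervalIntegrable
      (fun t ↦ 1 / Real.log t - 1 / Real.log x) volume a b :=
    fun ha hb ↦ (intervalIntegrable_inv_log ha hb).sub (by simp)
  have : ∫ t in x..y, (1 / Real.log t - 1 / Real.log x) ≤ 0 := by
    rcases le_total x y with h | h
    · rw [← neg_nonneg, ← intervalIntegral.integral_neg]
      refine intervalIntegral.integral_nonneg h fun t ht ↦ neg_nonneg.mpr (sub_nonpos.mpr ?_)
      exact one_div_le_one_div_of_le (Real.log_pos hx) (Real.log_le_log (by linarith) ht.1)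
    · rw [intervalIntegral.integral_symm, neg_nonpos]
      refine intervalIntegral.integral_nonneg h fun t ht ↦ sub_nonneg.mpr ?_
      exact one_div_le_one_div_of_le (Real.log_pos (by linarith [ht.1]))
        (Real.log_le_log (by linarith [ht.1]) ht.2)
  linarith [Li_sub_Li hx hy]

lemma abs_inv_log_sub_le {x t : ℝ} (hx : 4 ≤ x) (ht : x / 2 ≤ t) :
    |1 / Real.log t - 1 / Real.log x| ≤ 4 * |t - x| / (x * Real.log x ^ 2) := by
  have hx0 : 0 < x := by linarith
  have ht0 : 0 < t := by linarith
  have hL : 0 < Real.log x := Real.log_pos (by linarith)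
  have hl : Real.log x / 2 ≤ Real.log t := by
    rw [← Real.log_sqrt hx0.le]
    refine Real.log_le_log (by positivity) (le_trans ?_ ht)
    rw [Real.sqrt_le_left (by linarith)]; nlinarith
  have hl0 : 0 < Real.log t := by linarith
  have hd : |Real.log x - Real.log t| ≤ 2 * |t - x| / x := by
    rw [abs_le]
    have h1 := Real.log_le_sub_one_of_pos (show 0 < x / t by positivity)
    have h2 := Real.log_le_sub_one_of_pos (show 0 < t / x by positivity)
    rw [Real.log_div (by positivity) (by positivity)] at h1 h2
    have h3 : t / x - 1 ≤ 2 * |t - x| / x := by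
      rw [div_sub_one hx0.ne']; gcongr
      linarith [le_abs_self (t - x), abs_nonneg (t - x)]
    have h4 : x / t - 1 ≤ 2 * |t - x| / x := by
      rw [div_sub_one ht0.ne', div_le_div_iff₀ ht0 hx0]
      have : x - t ≤ |t - x| := by rw [abs_sub_comm]; exact le_abs_self _
      nlinarith [abs_nonneg (t - x)]
    constructor <;> linarith
  have : 1 / Real.log t - 1 / Real.log x =
      (Real.log x - Real.log t) / (Real.log t * Real.log x) := by field_simp
  rw [this, abs_div, abs_of_pos (show 0 < Real.log t * Real.log x by positivity)]
  calc _ ≤ (2 * |t - x| / x) / (Real.log x / 2 * Real.log x) := by gcongr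
    _ = _ := by field_simp; ring

lemma abs_Li_sub_Li_le {x y : ℝ} (hx : 4 ≤ x) (hy : x / 2 ≤ y) :
    |Li y - Li x - (y - x) / Real.log x| ≤ 4 * (y - x) ^ 2 / (x * Real.log x ^ 2) := by
  rw [Li_sub_Li (by linarith) (by linarith)]
  have hL : 0 < Real.log x := Real.log_pos (by linarith)
  have := intervalIntegral.norm_integral_le_of_norm_le_const (a := x) (b := y)
    (f := fun t ↦ 1 / Real.log t - 1 / Real.log x)
    (C := 4 * |y - x| / (x * Real.log x ^ 2)) fun t ht ↦ ?_
  · rw [Real.norm_eq_abs] at this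
    refine this.trans (le_of_eq ?_)
    rw [div_mul_eq_mul_div, mul_assoc, abs_mul_abs_self, ← sq]
  · have ht' : t ∈ uIcc x y := uIoc_subset_uIcc ht
    refine (abs_inv_log_sub_le hx ((le_min (by linarith) hy).trans ht'.1)).trans ?_
    have : |t - x| ≤ |y - x| := abs_sub_left_of_mem_uIcc ht'
    gcongr

lemma exists_psiSubThetaWeight_le :
    ∃ C, 0 ≤ C ∧ ∀ x, 2 ≤ x → psiSubThetaWeight x ≤ C * √x := by
  obtain ⟨C, hC⟩ := Chebyshev.psi_sub_theta_le_mul_sqrt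
  have hl2 : 0 < Real.log 2 := Real.log_pos (by norm_num)
  refine ⟨|C| / Real.log 2 + 2 * |C| / Real.log 2 ^ 2, by positivity, fun x hx ↦ ?_⟩
  have hx0 : 0 < x := by linarith
  have hlx : Real.log 2 ≤ Real.log x := Real.log_le_log (by norm_num) hx
  have hC' : ∀ x, Chebyshev.psi x - Chebyshev.theta x ≤ |C| * √x :=
    fun x ↦ (hC x).trans (by gcongr; exact le_abs_self C)
  have hint : ∫ t in (2 : ℝ)..x, t ^ (-(1 / 2) : ℝ) ≤ 2 * √x := by
    rw [integral_rpow (Or.inl (by norm_num))]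
    rw [Real.sqrt_eq_rpow]
    have : (0 : ℝ) ≤ 2 ^ (-(1 / 2) + 1 : ℝ) := by positivity
    norm_num at this ⊢
    linarith
  have hJ : ∫ t in (2 : ℝ)..x, (Chebyshev.psi t - Chebyshev.theta t) / (t * Real.log t ^ 2) ≤
      |C| / Real.log 2 ^ 2 * ∫ t in (2 : ℝ)..x, t ^ (-(1 / 2) : ℝ) := by
    rw [← intervalIntegral.integral_const_mul]
    refine intervalIntegral.integral_mono_on hx
      (intervalIntegrable_psi_sub_theta_div (by norm_num) (by linarith))
      ((intervalIntegral.intervalIntegrable_rpow' (by norm_num)).const_mul _) fun t ht ↦ ?_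
    have ht0 : 0 < t := by linarith [ht.1]
    have hlt : Real.log 2 ≤ Real.log t := Real.log_le_log (by norm_num) ht.1
    calc _ ≤ |C| * √t / (t * Real.log 2 ^ 2) := by
          gcongr; exact hC' t
      _ = |C| / Real.log 2 ^ 2 * (√t / t) := by field_simp
      _ = _ := by
          rw [Real.sqrt_eq_rpow, ← Real.rpow_sub_one ht0.ne']; norm_num
  rw [psiSubThetaWeight, add_mul]
  refine add_le_add ?_ (hJ.trans ?_)
  · calc _ ≤ |C| * √x / Real.log 2 := by gcongr; exact hC' x
      _ = _ := by ring
  · calc _ ≤ |C| / Real.log 2 ^ 2 * (2 * √x) := by gcongr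
      _ = _ := by ring

lemma eventually_half_le_psi : ∀ᶠ x : ℝ in atTop, x / 2 ≤ Chebyshev.psi x := by
  have h : Tendsto (fun x : ℝ ↦ Real.log (x + 2) / (x + 2)) atTop (𝓝 0) :=
    (Real.isLittleO_log_id_atTop.tendsto_div_nhds_zero).comp
      (tendsto_atTop_add_const_right _ 2 tendsto_id)
  filter_upwards [h.eventually (gt_mem_nhds (show (0 : ℝ) < 1 / 20 by norm_num)),
    eventually_ge_atTop 20] with x hx hx1
  have := Chebyshev.psi_ge' (show 0 ≤ x by linarith)
  rw [div_lt_iff₀ (by linarith)] at hx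
  have := Real.log_two_gt_d9
  nlinarith

lemma eventually_le_psiSubThetaWeight :
    ∀ᶠ x : ℝ in atTop, √x / (2 * Real.log x) ≤ psiSubThetaWeight x := by
  filter_upwards [Real.tendsto_sqrt_atTop.eventually eventually_half_le_psi,
    eventually_ge_atTop 2] with x hx hx2
  have hL : 0 < Real.log x := Real.log_pos (by linarith)
  have h1 := Chebyshev.psi_sub_theta_ge_psi_add_psi_add_psi (show 0 ≤ x by linarith)
  have h2 := Chebyshev.psi_nonneg (x ^ (3 : ℝ)⁻¹)
  have h3 := Chebyshev.psi_nonneg (x ^ (7 : ℝ)⁻¹)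
  rw [Real.sqrt_eq_rpow] at hx
  norm_num at h1 h2 h3 hx
  have hJ : 0 ≤ ∫ t in (2 : ℝ)..x,
      (Chebyshev.psi t - Chebyshev.theta t) / (t * Real.log t ^ 2) := by
    refine intervalIntegral.integral_nonneg hx2 fun t ht ↦ ?_
    have := Chebyshev.theta_le_psi t
    have : 0 ≤ t := by linarith [ht.1]
    exact div_nonneg (by linarith) (by positivity)
  rw [psiSubThetaWeight, Real.sqrt_eq_rpow]
  norm_num
  have : x ^ (1 / 2 : ℝ) / (2 * Real.log x) = (x ^ (1 / 2 : ℝ) / 2) / Real.log x := by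
    field_simp
  rw [this]
  have : (x ^ (1 / 2 : ℝ) / 2) / Real.log x ≤
    (Chebyshev.psi x - Chebyshev.theta x) / Real.log x := by gcongr; linarith
  linarith

lemma exists_Li_psi_sub_le : ∃ C, 0 ≤ C ∧ ∀ᶠ x : ℝ in atTop,
    Li (Chebyshev.psi x) - Nat.primeCounting ⌊x⌋₊ ≤ -psiErrLogInt x + C * √x := by
  obtain ⟨C, hC0, hC⟩ := exists_psiSubThetaWeight_le
  refine ⟨C, hC0, ?_⟩
  filter_upwards [eventually_half_le_psi, eventually_ge_atTop 4] with x hx hx4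
  have h1 := Li_le_add (x := x) (y := Chebyshev.psi x) (by linarith) (by linarith)
  rw [primeCounting_eq_Li_add (by linarith)]
  have h2 := hC x (by linarith)
  have h3 : (Chebyshev.psi x - x) / Real.log x ≤ psiErr x / Real.log x := by
    have := Real.log_pos (show 1 < x by linarith)
    gcongr; simp [psiErr]
  have : 0 < 1 / Real.log 2 := one_div_pos.mpr (Real.log_pos (by norm_num))
  linarith

lemma eventually_le_Li_psi_sub : ∀ᶠ x : ℝ in atTop,
    -psiErrLogInt x + √x / (2 * Real.log x) -
      4 * (Chebyshev.psi x - x) ^ 2 / (x * Real.log x ^ 2) - 2 / Real.log 2 ≤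
    Li (Chebyshev.psi x) - Nat.primeCounting ⌊x⌋₊ := by
  filter_upwards [eventually_half_le_psi, eventually_le_psiSubThetaWeight,
    eventually_ge_atTop 4] with x hx hx2 hx4
  have h1 := (abs_le.mp (abs_Li_sub_Li_le hx4 hx)).1
  rw [primeCounting_eq_Li_add (by linarith)]
  have h3 : psiErr x / Real.log x = (Chebyshev.psi x - x) / Real.log x + 1 / Real.log x := by
    rw [psiErr]; ring
  have : 1 / Real.log x ≤ 1 / Real.log 2 :=
    one_div_le_one_div_of_le (Real.log_pos (by norm_num))
      (Real.log_le_log (by norm_num) (by linarith))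
  have h5 : 2 / Real.log 2 = 1 / Real.log 2 + 1 / Real.log 2 := by ring
  linarith

lemma psiErrInt_sub {a b : ℝ} :
    psiErrInt b - psiErrInt a = ∫ t in a..b, psiErr t :=
  intervalIntegral.integral_interval_sub_left (intervalIntegrable_psiErr _ _)
    (intervalIntegrable_psiErr _ _)

lemma mul_psiErr_le_psiErrInt_sub {x h : ℝ} (hh : 0 ≤ h) :
    h * (psiErr x - h) ≤ psiErrInt (x + h) - psiErrInt x := by
  rw [psiErrInt_sub]
  have : ∫ t in x..x + h, (psiErr x - h) = h * (psiErr x - h) := by simp; ring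
  rw [← this]
  refine intervalIntegral.integral_mono_on (by linarith) (by simp)
    (intervalIntegrable_psiErr _ _) fun t ht ↦ ?_
  have := Chebyshev.psi_mono ht.1
  simp only [psiErr]; linarith [ht.2]

lemma psiErrInt_sub_le_mul_psiErr {x h : ℝ} (hh : 0 ≤ h) :
    psiErrInt x - psiErrInt (x - h) ≤ h * (psiErr x + h) := by
  rw [psiErrInt_sub]
  have : ∫ t in (x - h)..x, (psiErr x + h) = h * (psiErr x + h) := by simp; ring
  rw [← this]
  refine intervalIntegral.integral_mono_on (by linarith)
    (intervalIntegrable_psiErr _ _) (by simp) fun t ht ↦ ?_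
  have := Chebyshev.psi_mono ht.2
  simp only [psiErr]; linarith [ht.1]

lemma eventually_abs_psiErr_le
    (hE : ∀ ε : ℝ, 0 < ε → ∀ᶠ x : ℝ in atTop, |psiErrInt x| ≤ ε * x ^ (3 / 2 : ℝ) * Real.log x)
    {η : ℝ} (hη : 0 < η) (hη1 : η ≤ 1) :
    ∀ᶠ x : ℝ in atTop, |psiErr x| ≤ 2 * (η * √(x ^ (3 / 2 : ℝ) * Real.log x)) := by
  have h2 := hE (η ^ 2 / 9) (by positivity)
  obtain ⟨X, hX⟩ := eventually_atTop.mp h2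
  have hlog : ∀ᶠ x : ℝ in atTop, Real.log x ≤ (1 / 4) * x ^ (1 / 2 : ℝ) := by
    filter_upwards [(isLittleO_log_rpow_atTop (r := 1 / 2) (by norm_num)).bound
      (show (0 : ℝ) < 1 / 4 by norm_num), eventually_ge_atTop 1] with x hx hx1
    rwa [Real.norm_of_nonneg (Real.log_nonneg hx1), Real.norm_of_nonneg (by positivity)] at hx
  filter_upwards [hlog, eventually_ge_atTop (2 * X), eventually_ge_atTop 2] with x hlx hxX hx2
  have hx0 : 0 < x := by linarith
  have hL : 0 < Real.log x := Real.log_pos (by linarith)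
  set M := x ^ (3 / 2 : ℝ) * Real.log x with hM
  have hM0 : 0 < M := by positivity
  set h := η * √M with hh
  have hh0 : 0 < h := by positivity
  have hsq : h ^ 2 = η ^ 2 * M := by rw [hh, mul_pow, Real.sq_sqrt hM0.le]
  have hMx : M ≤ x ^ 2 / 4 := by
    calc M ≤ x ^ (3 / 2 : ℝ) * ((1 / 4) * x ^ (1 / 2 : ℝ)) := by rw [hM]; gcongr
      _ = x ^ (3 / 2 + 1 / 2 : ℝ) / 4 := by rw [Real.rpow_add hx0]; ring
      _ = _ := by norm_num
  have hhx : h ≤ x / 2 := by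
    refine le_of_sq_le_sq ?_ (by positivity)
    rw [hsq]
    have : η ^ 2 ≤ 1 := pow_le_one₀ hη.le hη1
    nlinarith
  have bound : ∀ y, x / 2 ≤ y → y ≤ 2 * x → |psiErrInt y| ≤ 7 / 9 * h ^ 2 := by
    intro y hy1 hy2
    have hy0 : 0 < y := by linarith
    refine (hX y (by linarith)).trans ?_
    have h1 : y ^ (3 / 2 : ℝ) ≤ 3 * x ^ (3 / 2 : ℝ) := by
      calc y ^ (3 / 2 : ℝ) ≤ (2 * x) ^ (3 / 2 : ℝ) := by gcongr
        _ = 2 ^ (3 / 2 : ℝ) * x ^ (3 / 2 : ℝ) := Real.mul_rpow (by norm_num) hx0.le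
        _ ≤ _ := by
          gcongr
          refine le_of_sq_le_sq ?_ (by norm_num)
          rw [← Real.rpow_natCast, ← Real.rpow_mul (by norm_num)]
          norm_num
    have h2 : Real.log y ≤ 2 * Real.log x := by
      have : Real.log y ≤ Real.log (2 * x) := Real.log_le_log hy0 hy2
      rw [Real.log_mul (by norm_num) hx0.ne'] at this
      have : Real.log 2 ≤ Real.log x := Real.log_le_log (by norm_num) hx2
      linarith
    calc η ^ 2 / 9 * y ^ (3 / 2 : ℝ) * Real.log y ≤
          η ^ 2 / 9 * y ^ (3 / 2 : ℝ) * (2 * Real.log x) := by gcongr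
      _ ≤ η ^ 2 / 9 * (3 * x ^ (3 / 2 : ℝ)) * (2 * Real.log x) := by gcongr
      _ = 6 / 9 * (η ^ 2 * M) := by rw [hM]; ring
      _ ≤ _ := by rw [hsq]; nlinarith [show 0 < η ^ 2 * M by positivity]
  have bx : |psiErrInt x| ≤ 1 / 9 * h ^ 2 := by
    refine (hX x (by linarith)).trans (le_of_eq ?_)
    rw [hsq, hM]; ring
  have b1 := bound (x + h) (by linarith) (by linarith)
  have b2 := bound (x - h) (by linarith) (by linarith)
  have u := mul_psiErr_le_psiErrInt_sub (x := x) hh0.le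
  have l := psiErrInt_sub_le_mul_psiErr (x := x) hh0.le
  rw [abs_le] at bx b1 b2 ⊢
  constructor
  · by_contra! hc
    nlinarith
  · by_contra! hc
    nlinarith

lemma hasDerivAt_one_div_mul_log_sq {t : ℝ} (ht : 1 < t) :
    HasDerivAt (fun t : ℝ ↦ 1 / (t * Real.log t ^ 2))
      (-(Real.log t + 2) / (t ^ 2 * Real.log t ^ 3)) t := by
  have h2 := Real.log_pos ht
  have h3 : t ≠ 0 := by linarith
  have := (((hasDerivAt_id t).mul ((Real.hasDerivAt_log h3).pow 2)).inv
    (show t * Real.log t ^ 2 ≠ 0 by positivity))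
  convert! this using 1
  · ext t; simp
  · simp; field_simp

lemma psiErrLogInt_sub_eq {a b : ℝ} (ha : 1 < a) (hab : a ≤ b) :
    psiErrLogInt b - psiErrLogInt a =
      psiErrInt b / (b * Real.log b ^ 2) - psiErrInt a / (a * Real.log a ^ 2) +
        ∫ t in a..b, psiErrInt t * ((Real.log t + 2) / (t ^ 2 * Real.log t ^ 3)) := by
  have hb : 1 < b := by linarith
  have h2 : (1 : ℝ) < 2 := by norm_num
  have i1 := intervalIntegrable_psiErr_div ha hb
  have i2 : IntervalIntegrable
      (fun t ↦ psiErrInt t * ((Real.log t + 2) / (t ^ 2 * Real.log t ^ 3))) volume a b := by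
    refine ContinuousOn.intervalIntegrable fun t ht ↦ ContinuousAt.continuousWithinAt ?_
    have h1 := pos_of_mem_uIcc ha hb ht
    have h2 := Real.log_pos h1
    have h3 : t ≠ 0 := by linarith
    refine continuous_psiErrInt.continuousAt.mul ?_
    fun_prop (disch := positivity)
  have key := integral_eq_of_hasDerivAt_off_countable_of_le
    (fun t ↦ psiErrInt t * (1 / (t * Real.log t ^ 2)))
    (fun t ↦ psiErr t / (t * Real.log t ^ 2) -
      psiErrInt t * ((Real.log t + 2) / (t ^ 2 * Real.log t ^ 3))) hab
    Chebyshev.psi_mono.countable_not_continuousAt ?_ ?_ (i1.sub i2)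
  · rw [intervalIntegral.integral_sub i1 i2] at key
    rw [psiErrLogInt, psiErrLogInt, intervalIntegral.integral_interval_sub_left
      (intervalIntegrable_psiErr_div h2 hb) (intervalIntegrable_psiErr_div h2 ha)]
    simp only [mul_one_div] at key
    linarith
  · exact continuous_psiErrInt.continuousOn.mul
      ((continuousOn_one_div_mul_log_sq ha hb).mono Icc_subset_uIcc)
  · intro t ht
    have hc : ContinuousAt Chebyshev.psi t := by simpa using ht.2
    have hc' : ContinuousAt psiErr t := by unfold psiErr; fun_prop
    have hd : HasDerivAt psiErrInt (psiErr t) t :=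
      intervalIntegral.integral_hasDerivAt_right (intervalIntegrable_psiErr _ _)
        measurable_psiErr.stronglyMeasurable.stronglyMeasurableAtFilter hc'
    convert! hd.mul (hasDerivAt_one_div_mul_log_sq (ha.trans ht.1.1)) using 1
    ring

lemma hasDerivAt_sqrt_div_log {t : ℝ} (ht : 1 < t) :
    HasDerivAt (fun t : ℝ ↦ √t / Real.log t)
      ((Real.log t - 2) / (2 * √t * Real.log t ^ 2)) t := by
  have h2 := Real.log_pos ht
  have h3 : t ≠ 0 := by linarith
  have h4 : 0 < t := by linarith
  convert! (Real.hasDerivAt_sqrt h3).div (Real.hasDerivAt_log h3) h2.ne' using 1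
  have := Real.sq_sqrt h4.le
  have h5 : √t ≠ 0 := by positivity
  field_simp
  rw [this]; ring

lemma tendsto_sqrt_div_log : Tendsto (fun x : ℝ ↦ √x / Real.log x) atTop atTop := by
  have h := (isLittleO_log_rpow_atTop (r := 1 / 2) (by norm_num)).tendsto_div_nhds_zero
  have h' : Tendsto (fun x : ℝ ↦ Real.log x / x ^ (1 / 2 : ℝ)) atTop (𝓝[>] 0) := by
    refine tendsto_nhdsWithin_iff.mpr ⟨h, ?_⟩
    filter_upwards [eventually_gt_atTop 1] with x hx
    have := Real.log_pos hx
    have : 0 < x := by linarith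
    exact mem_Ioi.mpr (by positivity)
  refine h'.inv_tendsto_nhdsGT_zero.congr fun x ↦ ?_
  simp [Real.sqrt_eq_rpow]

lemma eventually_abs_psiErrLogInt_le
    (hE : ∀ ε : ℝ, 0 < ε → ∀ᶠ x : ℝ in atTop, |psiErrInt x| ≤ ε * x ^ (3 / 2 : ℝ) * Real.log x)
    {ε : ℝ} (hε : 0 < ε) :
    ∀ᶠ x : ℝ in atTop, |psiErrLogInt x| ≤ 10 * ε * (√x / Real.log x) := by
  obtain ⟨X, hX⟩ := eventually_atTop.mp (hE ε hε)
  set T := max X (Real.exp 4) with hT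
  have hT4 : Real.exp 4 ≤ T := le_max_right _ _
  have hT1 : 1 < T := lt_of_lt_of_le (by simp) hT4
  have bound : ∀ t, T ≤ t → |psiErrInt t| ≤ ε * (t * √t) * Real.log t := by
    intro t ht
    have h0 : 0 < t := by linarith
    refine (hX t ((le_max_left _ _).trans ht)).trans (le_of_eq ?_)
    rw [show (3 / 2 : ℝ) = 1 + 1 / 2 by norm_num, Real.rpow_add h0, Real.rpow_one,
      Real.sqrt_eq_rpow]
  have hlogT : ∀ t, T ≤ t → 4 ≤ Real.log t := fun t ht ↦ by
    rw [Real.le_log_iff_exp_le (by linarith)]; linarith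
  set K := |psiErrLogInt T| + |psiErrInt T / (T * Real.log T ^ 2)|
  filter_upwards [eventually_ge_atTop T, tendsto_sqrt_div_log.eventually_ge_atTop (K / ε)]
    with x hx hxK
  have hx1 : 1 < x := by linarith
  have hx0 : 0 < x := by linarith
  have hL := hlogT x hx
  have hL0 : 0 < Real.log x := by linarith
  have hTL := hlogT T le_rfl
  rw [div_le_iff₀ hε] at hxK
  have e := psiErrLogInt_sub_eq hT1 hx
  have hEx : |psiErrInt x / (x * Real.log x ^ 2)| ≤ ε * (√x / Real.log x) := by
    rw [abs_div, abs_of_pos (show 0 < x * Real.log x ^ 2 by positivity)]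
    calc _ ≤ ε * (x * √x) * Real.log x / (x * Real.log x ^ 2) := by gcongr; exact bound x hx
      _ = _ := by field_simp
  have hc : ContinuousOn (fun t : ℝ ↦ (Real.log t - 2) / (2 * √t * Real.log t ^ 2)) (uIcc T x) := by
    intro t ht
    have h1 := pos_of_mem_uIcc hT1 hx1 ht
    have h2 := Real.log_pos h1
    have h3 : t ≠ 0 := by linarith
    have h4 : 0 < √t := Real.sqrt_pos.mpr (by linarith)
    refine ContinuousAt.continuousWithinAt ?_
    fun_prop (disch := positivity)
  have hint : |∫ t in T..x, psiErrInt t * ((Real.log t + 2) / (t ^ 2 * Real.log t ^ 3))| ≤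
      6 * ε * (√x / Real.log x - √T / Real.log T) := by
    rw [← intervalIntegral.integral_eq_sub_of_hasDerivAt (f := fun t ↦ √t / Real.log t)
      (fun t ht ↦ hasDerivAt_sqrt_div_log (pos_of_mem_uIcc hT1 hx1 ht)) hc.intervalIntegrable,
      ← intervalIntegral.integral_const_mul, ← Real.norm_eq_abs]
    refine intervalIntegral.norm_integral_le_of_norm_le hx ?_
      (hc.intervalIntegrable.const_mul _)
    refine Eventually.of_forall fun t ht ↦ ?_
    have htT := ht.1.le
    have h0 : 0 < t := by linarith
    have hl := hlogT t htT
    have hl0 : 0 < Real.log t := by linarith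
    have hs := Real.sqrt_pos.mpr h0
    rw [Real.norm_eq_abs, abs_mul, abs_of_pos (a := _ / _) (by positivity)]
    calc _ ≤ (ε * (t * √t) * Real.log t) * ((Real.log t + 2) / (t ^ 2 * Real.log t ^ 3)) := by
          gcongr; exact bound t htT
      _ = (ε / (√t * Real.log t ^ 2)) * (Real.log t + 2) := by
          have := Real.sq_sqrt h0.le
          field_simp
          rw [this]
      _ ≤ (ε / (√t * Real.log t ^ 2)) * (3 * (Real.log t - 2)) := by gcongr; linarith
      _ = _ := by field_simp; ring
  have hTpos : 0 ≤ √T / Real.log T := by positivity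
  have h1 : |psiErrLogInt x| ≤ K + ε * (√x / Real.log x) + 6 * ε * (√x / Real.log x) := by
    have : psiErrLogInt x = psiErrLogInt T + psiErrInt x / (x * Real.log x ^ 2)
      - psiErrInt T / (T * Real.log T ^ 2) +
        ∫ t in T..x, psiErrInt t * ((Real.log t + 2) / (t ^ 2 * Real.log t ^ 3)) := by
      linarith
    have h3 := mul_nonneg hε.le hTpos
    rw [this]
    refine (abs_add_le _ _).trans ?_
    have := abs_sub (psiErrLogInt T + psiErrInt x / (x * Real.log x ^ 2))
      (psiErrInt T / (T * Real.log T ^ 2))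
    have := abs_add_le (psiErrLogInt T) (psiErrInt x / (x * Real.log x ^ 2))
    simp only [K]
    linarith
  have : 0 ≤ ε * (√x / Real.log x) := by positivity
  linarith

lemma eventually_Li_psi_sub_pos_of_isLittleO
    (hE : ∀ ε : ℝ, 0 < ε → ∀ᶠ x : ℝ in atTop, |psiErrInt x| ≤ ε * x ^ (3 / 2 : ℝ) * Real.log x) :
    ∀ᶠ x : ℝ in atTop, 0 < Li (Chebyshev.psi x) - Nat.primeCounting ⌊x⌋₊ := by
  have h1 := eventually_abs_psiErr_le hE (η := 1 / 20) (by norm_num) (by norm_num)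
  have h2 := eventually_abs_psiErrLogInt_le hE (ε := 1 / 100) (by norm_num)
  filter_upwards [h1, h2, eventually_le_Li_psi_sub, tendsto_sqrt_div_log.eventually_ge_atTop 100,
    eventually_ge_atTop (Real.exp 4)] with x h1 h2 h3 h4 h5
  have hx1 : 1 < x := lt_of_lt_of_le (by simp) h5
  have hx0 : 0 < x := by linarith
  have hL : 4 ≤ Real.log x := by rwa [Real.le_log_iff_exp_le hx0]
  have hL0 : 0 < Real.log x := by linarith
  set R := √x / Real.log x with hR
  have e1 : √x / (2 * Real.log x) = R / 2 := by rw [hR]; field_simp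
  have hM0 : 0 < x ^ (3 / 2 : ℝ) * Real.log x := by positivity
  have hM1 : 1 ≤ x ^ (3 / 2 : ℝ) * Real.log x := by
    have := Real.one_le_rpow hx1.le (show (0 : ℝ) ≤ 3 / 2 by norm_num)
    nlinarith
  have hsM := Real.sq_sqrt hM0.le
  have hd : |Chebyshev.psi x - x| ^ 2 ≤ 4 / 100 * (x ^ (3 / 2 : ℝ) * Real.log x) + 2 := by
    have : |Chebyshev.psi x - x| ≤ 1 / 10 * √(x ^ (3 / 2 : ℝ) * Real.log x) + 1 := by
      have := abs_sub (psiErr x) 1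
      rw [psiErr] at this h1
      simp at this
      rw [show Chebyshev.psi x - x = Chebyshev.psi x - x + 1 - 1 by ring]
      simp at *
      linarith
    have h0 := abs_nonneg (Chebyshev.psi x - x)
    calc _ ≤ (1 / 10 * √(x ^ (3 / 2 : ℝ) * Real.log x) + 1) ^ 2 := by gcongr
      _ ≤ _ := by nlinarith [sq_nonneg (1 / 10 * √(x ^ (3 / 2 : ℝ) * Real.log x) - 1)]
  rw [sq_abs] at hd
  have e2 : 4 * (Chebyshev.psi x - x) ^ 2 / (x * Real.log x ^ 2) ≤ 16 / 100 * R + 1 := by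
    have e3 : x ^ (3 / 2 : ℝ) = x * √x := by
      rw [show (3 / 2 : ℝ) = 1 + 1 / 2 by norm_num, Real.rpow_add hx0, Real.rpow_one,
        Real.sqrt_eq_rpow]
    rw [e3] at hd
    calc _ ≤ 4 * (4 / 100 * (x * √x * Real.log x) + 2) / (x * Real.log x ^ 2) := by gcongr
      _ = 16 / 100 * R + 8 / (x * Real.log x ^ 2) := by rw [hR]; field_simp; ring
      _ ≤ _ := by
        gcongr
        rw [div_le_one (by positivity)]
        nlinarith
  have e4 : 2 / Real.log 2 ≤ 4 := by
    have := Real.log_two_gt_d9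
    rw [div_le_iff₀ (by linarith)]; linarith
  have := (abs_le.mp h2).2
  rw [e1] at h3
  linarith

open ProbabilityTheory in
/-- Landau lemma: if the moment generating function of a nonnegative variable continues
analytically to a disc, then it is finite on the real points of this disc. -/
lemma add_mem_integrableExpSet_of_differentiableOn {Ω : Type*} [MeasurableSpace Ω]
    {μ : Measure Ω} {X : Ω → ℝ} (hX : 0 ≤ᵐ[μ] X) {t r d : ℝ}
    (ht : t ∈ interior (integrableExpSet X μ)) {f : ℂ → ℂ}
    (hf : DifferentiableOn ℂ f (Metric.ball (t : ℂ) r))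
    (heq : f =ᶠ[𝓝 (t : ℂ)] complexMGF X μ) (hd0 : 0 ≤ d) (hdr : d < r) :
    t + d ∈ integrableExpSet X μ := by
  have hXm := aemeasurable_of_mem_interior_integrableExpSet ht
  obtain ⟨R, hdR, hRr⟩ := exists_between hdr
  have hR0 : 0 < R := hd0.trans_lt hdR
  have hsub : Metric.closedBall (t : ℂ) R ⊆ Metric.ball (t : ℂ) r :=
    Metric.closedBall_subset_ball hRr
  obtain ⟨M, hM⟩ := (isCompact_closedBall (t : ℂ) R).exists_bound_of_continuousOn
    (hf.continuousOn.mono hsub)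
  have hint (n : ℕ) : Integrable (fun ω ↦ X ω ^ n * Real.exp (t * X ω)) μ :=
    integrable_pow_mul_exp_of_mem_interior_integrableExpSet ht n
  have hm (n : ℕ) : ∫ ω, X ω ^ n * Real.exp (t * X ω) ∂μ ≤ n.factorial * M / R ^ n := by
    have h1 := Complex.norm_iteratedDeriv_le_of_forall_mem_sphere_norm_le n hR0
      ((hf.mono hsub).diffContOnCl_ball subset_rfl)
      fun z hz ↦ hM z (Metric.sphere_subset_closedBall hz)
    rw [heq.iteratedDeriv_eq n, iteratedDeriv_complexMGF (by simpa using ht)] at h1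
    have h2 : ∫ ω, (X ω : ℂ) ^ n * Complex.exp ((t : ℂ) * X ω) ∂μ =
        ((∫ ω, X ω ^ n * Real.exp (t * X ω) ∂μ : ℝ) : ℂ) := by
      rw [← integral_complex_ofReal]
      congr 1 with ω
      push_cast; rfl
    rw [h2, Complex.norm_real] at h1
    exact (Real.le_norm_self _).trans h1
  have hnn : ∀ n : ℕ, 0 ≤ᵐ[μ] fun ω ↦ d ^ n / n.factorial * (X ω ^ n * Real.exp (t * X ω)) := by
    intro n
    filter_upwards [hX] with ω hω
    have : 0 ≤ X ω := hω
    simp only [Pi.zero_apply]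
    positivity
  have hexp : ∀ᵐ ω ∂μ, ENNReal.ofReal (Real.exp ((t + d) * X ω)) =
      ∑' n : ℕ, ENNReal.ofReal (d ^ n / n.factorial * (X ω ^ n * Real.exp (t * X ω))) := by
    filter_upwards [ae_all_iff.mpr hnn] with ω hω
    have hs : HasSum (fun n : ℕ ↦ d ^ n / n.factorial * (X ω ^ n * Real.exp (t * X ω)))
        (Real.exp ((t + d) * X ω)) := by
      have := (NormedSpace.expSeries_div_hasSum_exp (d * X ω)).mul_right (Real.exp (t * X ω))
      rw [← Real.exp_eq_exp_ℝ, ← Real.exp_add] at this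
      convert! this using 1
      · ext n; rw [mul_pow]; ring
      · ring_nf
    rw [← ENNReal.ofReal_tsum_of_nonneg hω hs.summable, hs.tsum_eq]
  have hexpm : AEMeasurable (fun ω ↦ Real.exp ((t + d) * X ω)) μ := by fun_prop
  refine ⟨hexpm.aestronglyMeasurable, ?_⟩
  rw [hasFiniteIntegral_iff_ofReal (Eventually.of_forall fun ω ↦ (Real.exp_pos _).le),
    lintegral_congr_ae hexp, lintegral_tsum fun n ↦ by fun_prop]
  have hgeom : Summable fun n : ℕ ↦ M * (d / R) ^ n :=
    (summable_geometric_of_lt_one (by positivity) ((div_lt_one hR0).mpr hdR)).mul_left M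
  refine lt_of_le_of_lt (ENNReal.tsum_le_tsum fun n ↦ ?_) hgeom.tsum_ofReal_lt_top
  rw [← ofReal_integral_eq_lintegral_ofReal ((hint n).const_mul _) (hnn n), integral_const_mul]
  refine ENNReal.ofReal_le_ofReal ?_
  calc _ ≤ d ^ n / n.factorial * (n.factorial * M / R ^ n) := by gcongr; exact hm n
    _ = _ := by
      have : (n.factorial : ℝ) ≠ 0 := by positivity
      rw [div_pow]; field_simp

/-- A holomorphic function on a convex set whose derivative extends to a disc extends to the
disc. -/
lemma exists_extension_of_deriv_eqOn {V : Set ℂ} {c : ℂ} {r : ℝ}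
    (hV : IsOpen V) (hVc : Convex ℝ V) {f h : ℂ → ℂ} (hf : DifferentiableOn ℂ f V)
    (hh : DifferentiableOn ℂ h (Metric.ball c r)) (hfh : EqOn (deriv f) h (Metric.ball c r ∩ V)) :
    ∃ g, DifferentiableOn ℂ g (Metric.ball c r) ∧ EqOn g f (Metric.ball c r ∩ V) ∧
      EqOn (deriv g) h (Metric.ball c r) := by
  rcases (Metric.ball c r ∩ V).eq_empty_or_nonempty with he | ⟨z₀, hz₀⟩
  · obtain ⟨g, hg⟩ := hh.isExactOn_ball
    exact ⟨g, fun z hz ↦ (hg z hz).differentiableAt.differentiableWithinAt, by simp [he],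
      fun z hz ↦ (hg z hz).deriv⟩
  · obtain ⟨g, hg0, hg⟩ := hh.isExactOn_ball.with_val_at z₀ (f z₀)
    refine ⟨g, fun z hz ↦ (hg z hz).differentiableAt.differentiableWithinAt, ?_,
      fun z hz ↦ (hg z hz).deriv⟩
    have ho : IsOpen (Metric.ball c r ∩ V) := Metric.isOpen_ball.inter hV
    refine ho.eqOn_of_deriv_eq ((convex_ball c r).inter hVc).isPreconnected
      (fun z hz ↦ (hg z hz.1).differentiableAt.differentiableWithinAt) (hf.mono inter_subset_right)
      (fun z hz ↦ ?_) hz₀ hg0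
    rw [hfh hz, (hg z hz.1).deriv]

/-- The integrand of `psiErrLogInt`, extended by zero to `t ≤ 2`. -/
noncomputable def psiErrLogTail (t : ℝ) : ℝ := if 2 < t then psiErr t / (t * Real.log t ^ 2) else 0

/-- The error term `ψ(t) - t + 1`, truncated to `t ≤ 2`. -/
noncomputable def psiErrHead (t : ℝ) : ℝ := if 2 < t then 0 else psiErr t

/-- The primitive of `psiErrLogTail`; it agrees with `psiErrLogInt` for `x ≥ 2`. -/
noncomputable def psiErrLogTailInt (x : ℝ) : ℝ := ∫ t in (1 : ℝ)..x, psiErrLogTail t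

/-- The function to which the Landau lemma applies. -/
noncomputable def landauFun (K x : ℝ) : ℝ := K * √x - psiErrLogTailInt x

/-- The measure on `(1, ∞)` with density `landauFun K x / x`. -/
noncomputable def landauMeasure (K : ℝ) : Measure ℝ :=
  (volume.restrict (Ioi 1)).withDensity fun x ↦ ENNReal.ofReal (landauFun K x / x)

/-- The Mellin transform of `landauFun K`, written as the moment generating function of `log`. -/
noncomputable def landauTransform (K : ℝ) (s : ℂ) : ℂ :=
  ProbabilityTheory.complexMGF Real.log (landauMeasure K) (-s)

/-- An analytic expression for the Mellin transform of `t ↦ t * psiErrLogTail t`. -/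
noncomputable def landauRemainder (K : ℝ) (s : ℂ) : ℂ :=
  K * s / (s - 1 / 2) - s * landauTransform K s

lemma measurable_psiErrLogTail : Measurable psiErrLogTail :=
  Measurable.ite measurableSet_Ioi
    (measurable_psiErr.div (by fun_prop : Measurable fun t : ℝ ↦ t * Real.log t ^ 2))
    measurable_const

lemma abs_psiErrLogTail_le (t : ℝ) : |psiErrLogTail t| ≤ 14 := by
  rw [psiErrLogTail]
  split_ifs with h
  · have h0 : 0 < t := by linarith
    have hl2 := Real.log_two_gt_d9
    have hl : Real.log 2 ≤ Real.log t := Real.log_le_log (by norm_num) h.le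
    have hl0 : 0 < Real.log t := by linarith
    rw [abs_div, abs_of_pos (show 0 < t * Real.log t ^ 2 by positivity),
      div_le_iff₀ (by positivity)]
    have := abs_psiErr_le (show 1 ≤ t by linarith)
    have h3 : 6 ≤ 14 * Real.log t ^ 2 := by nlinarith
    nlinarith
  · simp

lemma intervalIntegrable_psiErrLogTail (a b : ℝ) :
    IntervalIntegrable psiErrLogTail volume a b := by
  refine (intervalIntegrable_const (c := (14 : ℝ))).mono_fun
    measurable_psiErrLogTail.aestronglyMeasurable (Eventually.of_forall fun t ↦ ?_)
  simpa using abs_psiErrLogTail_le t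

lemma continuous_psiErrLogTailInt : Continuous psiErrLogTailInt :=
  intervalIntegral.continuous_primitive intervalIntegrable_psiErrLogTail 1

lemma abs_psiErrLogTailInt_le {x : ℝ} (hx : 1 ≤ x) : |psiErrLogTailInt x| ≤ 14 * x := by
  have := intervalIntegral.norm_integral_le_of_norm_le_const (a := 1) (b := x)
    (f := psiErrLogTail) (C := 14) fun t _ ↦ abs_psiErrLogTail_le t
  rw [abs_of_nonneg (by linarith)] at this
  rw [psiErrLogTailInt, ← Real.norm_eq_abs]
  linarith

lemma psiErrLogTailInt_eq_zero {x : ℝ} (hx1 : 1 ≤ x) (hx : x ≤ 2) : psiErrLogTailInt x = 0 := by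
  refine intervalIntegral.integral_zero_ae (Eventually.of_forall fun t ht ↦ ?_)
  rw [uIoc_of_le hx1] at ht
  rw [psiErrLogTail, if_neg (by linarith [ht.2])]

lemma psiErrLogTailInt_eq {x : ℝ} (hx : 2 ≤ x) : psiErrLogTailInt x = psiErrLogInt x := by
  have h := intervalIntegral.integral_add_adjacent_intervals
    (intervalIntegrable_psiErrLogTail 1 2) (intervalIntegrable_psiErrLogTail 2 x)
  have h2 : ∫ t in (1 : ℝ)..2, psiErrLogTail t = 0 := psiErrLogTailInt_eq_zero (by norm_num) le_rfl
  rw [psiErrLogTailInt, ← h, h2, zero_add, psiErrLogInt]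
  refine intervalIntegral.integral_congr_ae (Eventually.of_forall fun t ht ↦ ?_)
  rw [uIoc_of_le hx] at ht
  rw [psiErrLogTail, if_pos ht.1]

lemma continuous_landauFun (K : ℝ) : Continuous (landauFun K) :=
  (by fun_prop : Continuous fun x : ℝ ↦ K * √x).sub continuous_psiErrLogTailInt

lemma abs_landauFun_le {K x : ℝ} (hK : 0 ≤ K) (hx : 1 ≤ x) : |landauFun K x| ≤ (K + 14) * x := by
  have h1 := abs_sub (K * √x) (psiErrLogTailInt x)
  have h2 := abs_psiErrLogTailInt_le hx
  have h3 : |K * √x| ≤ K * x := by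
    rw [abs_of_nonneg (by positivity)]
    gcongr
    rw [Real.sqrt_le_left (by linarith)]; nlinarith
  rw [landauFun]; linarith

lemma landauTransform_eq_tailMellin {K : ℝ} (hB : ∀ x, 1 < x → 0 ≤ landauFun K x) (s : ℂ) :
    landauTransform K s = tailMellin (fun x ↦ (landauFun K x : ℂ)) s := by
  have hm : Measurable fun x ↦ landauFun K x / x :=
    (continuous_landauFun K).measurable.div measurable_id
  rw [landauTransform, ProbabilityTheory.complexMGF, landauMeasure, tailMellin,
    integral_withDensity_eq_integral_toReal_smul₀ hm.ennreal_ofReal.aemeasurable (by simp)]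
  refine setIntegral_congr_fun measurableSet_Ioi fun x (hx : 1 < x) ↦ ?_
  have h0 : 0 < x := by linarith
  have hx0 : (x : ℂ) ≠ 0 := by exact_mod_cast h0.ne'
  have h1 := hB x hx
  rw [ENNReal.toReal_ofReal (by positivity), Complex.ofReal_log h0.le, Complex.real_smul,
    show -(s + 1) = -s - 1 by ring, Complex.cpow_sub _ _ hx0, Complex.cpow_one,
    Complex.cpow_def_of_ne_zero hx0]
  push_cast
  rw [mul_comm (Complex.log _)]
  ring

lemma mem_integrableExpSet_landauMeasure {K t : ℝ} (hB : ∀ x, 1 < x → 0 ≤ landauFun K x)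
    (hK : 0 ≤ K) (ht : t < -1) :
    t ∈ ProbabilityTheory.integrableExpSet Real.log (landauMeasure K) := by
  have hm : Measurable fun x ↦ landauFun K x / x :=
    (continuous_landauFun K).measurable.div measurable_id
  change Integrable _ _
  rw [landauMeasure, integrable_withDensity_iff hm.ennreal_ofReal (by simp)]
  have h := (integrableOn_tailMellin (f := fun x ↦ (landauFun K x : ℂ)) (s := ((-t : ℝ) : ℂ))
    (Complex.measurable_ofReal.comp (continuous_landauFun K).measurable) (C := K + 14) (a := 1)
    (fun x hx ↦ by
      rw [Complex.norm_real, Real.rpow_one]; exact abs_landauFun_le hK (le_of_lt hx))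
    (by rw [Complex.ofReal_re]; linarith)).norm
  refine h.congr ?_
  filter_upwards [ae_restrict_mem measurableSet_Ioi] with x hx
  have hx1 : 1 < x := hx
  have h0 : 0 < x := by linarith
  have h1 := hB x hx1
  rw [norm_mul, norm_cpow_neg_add_one h0, Complex.norm_real, Real.norm_of_nonneg h1,
    ENNReal.toReal_ofReal (by positivity), Complex.ofReal_re, neg_add, neg_neg,
    ← sub_eq_add_neg, Real.rpow_sub_one h0.ne', Real.rpow_def_of_pos h0, mul_comm t]
  ring

lemma tailMellin_sqrt {s : ℂ} (hs : 1 / 2 < s.re) :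
    tailMellin (fun x ↦ (√x : ℂ)) s = 1 / (s - 1 / 2) := by
  have h : tailMellin (fun x ↦ (√x : ℂ)) s = ∫ t in Ioi (1 : ℝ), (t : ℂ) ^ (-s - 1 / 2) := by
    refine setIntegral_congr_fun measurableSet_Ioi fun x (hx : 1 < x) ↦ ?_
    have h0 : 0 < x := by linarith
    have hx0 : (x : ℂ) ≠ 0 := by exact_mod_cast h0.ne'
    simp only
    rw [Real.sqrt_eq_rpow, Complex.ofReal_cpow h0.le, ← Complex.cpow_add _ _ hx0]
    congr 1; push_cast; ring
  rw [h, integral_Ioi_cpow_of_lt (by simp; linarith) one_pos]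
  have : s - 1 / 2 ≠ 0 := by
    intro h0; have := congrArg Complex.re h0; norm_num at this; linarith
  have h2 : -s - 1 / 2 + 1 = -(s - 1 / 2) := by ring
  rw [h2, Complex.ofReal_one, Complex.one_cpow, div_neg, neg_div, neg_neg]

lemma norm_psiErrLogTail_le (t : ℝ) (_ : t > 1) : ‖(psiErrLogTail t : ℂ)‖ ≤ 14 * t ^ (0 : ℝ) := by
  simpa using abs_psiErrLogTail_le t

lemma landauRemainder_eq {K : ℝ} (hB : ∀ x, 1 < x → 0 ≤ landauFun K x) {s : ℂ}
    (hs : 1 < s.re) :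
    landauRemainder K s = tailMellin (fun t ↦ t * (psiErrLogTail t : ℂ)) s := by
  have hgm : Measurable fun t ↦ (psiErrLogTail t : ℂ) :=
    Complex.measurable_ofReal.comp measurable_psiErrLogTail
  rw [← mul_tailMellin_integral hgm norm_psiErrLogTail_le (by linarith) (by linarith),
    landauRemainder, landauTransform_eq_tailMellin hB]
  have h1 : tailMellin (fun x ↦ (landauFun K x : ℂ)) s =
      K * tailMellin (fun x ↦ (√x : ℂ)) s -
        tailMellin (fun x ↦ ∫ t in Ioc 1 x, (psiErrLogTail t : ℂ)) s := by
    rw [tailMellin, tailMellin, tailMellin, ← integral_const_mul, ← integral_sub]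
    · refine setIntegral_congr_fun measurableSet_Ioi fun x (hx : 1 < x) ↦ ?_
      rw [integral_complex_ofReal, landauFun, psiErrLogTailInt,
        intervalIntegral.integral_of_le hx.le]
      push_cast; ring
    · refine (integrableOn_tailMellin (f := fun x ↦ (√x : ℂ)) (by fun_prop) (C := 1) (a := 1)
        (fun t (_ht : 1 < t) ↦ ?_) (by linarith)).const_mul _
      rw [Complex.norm_real, Real.norm_of_nonneg (by positivity), one_mul, Real.rpow_one,
        Real.sqrt_le_left (by linarith)]
      nlinarith
    · refine (integrableOn_tailMellin (f := fun x ↦ (psiErrLogTailInt x : ℂ)) (C := 14) (a := 1)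
        (Complex.measurable_ofReal.comp continuous_psiErrLogTailInt.measurable)
        (fun t ht ↦ ?_) (by linarith)).congr_fun (fun x (hx : 1 < x) ↦ ?_) measurableSet_Ioi
      · rw [Complex.norm_real, Real.rpow_one]; exact abs_psiErrLogTailInt_le (le_of_lt ht)
      · simp only
        rw [integral_complex_ofReal, psiErrLogTailInt, intervalIntegral.integral_of_le hx.le]
  rw [h1, tailMellin_sqrt (by linarith)]
  ring

lemma deriv_deriv_tailMellin_psiErrLogTail {s : ℂ} (hs : 1 < s.re) :
    deriv (deriv (tailMellin fun t ↦ t * (psiErrLogTail t : ℂ))) s =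
      tailMellin (fun t ↦ (psiErr t : ℂ) - psiErrHead t) s := by
  have hgm : Measurable fun t ↦ (psiErrLogTail t : ℂ) :=
    Complex.measurable_ofReal.comp measurable_psiErrLogTail
  have hlog : Measurable fun t : ℝ ↦ (Real.log t : ℂ) := by fun_prop
  obtain ⟨a, ha1, has⟩ := exists_between hs
  have b1 : ∀ t : ℝ, t > 1 → ‖(t : ℂ) * (psiErrLogTail t : ℂ)‖ ≤ 14 * t ^ (1 : ℝ) := by
    intro t ht
    have := norm_psiErrLogTail_le t ht
    rw [Real.rpow_zero] at this
    rw [norm_mul, Complex.norm_real, Real.norm_of_nonneg (by linarith), Real.rpow_one]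
    nlinarith
  have b2 : ∀ t : ℝ, t > 1 → ‖-(Real.log t : ℂ) * ((t : ℂ) * (psiErrLogTail t : ℂ))‖ ≤
      14 / (a - 1) * t ^ a := by
    intro t ht
    have h0 : 0 < t := by linarith
    have h1 := b1 t ht
    have h2 := Real.log_le_rpow_div h0.le (show 0 < a - 1 by linarith)
    have hl := Real.log_pos ht
    rw [norm_mul, norm_neg, Complex.norm_real, Real.norm_of_nonneg hl.le]
    calc _ ≤ t ^ (a - 1) / (a - 1) * (14 * t ^ (1 : ℝ)) := by gcongr
      _ = 14 / (a - 1) * (t ^ (a - 1) * t ^ (1 : ℝ)) := by ring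
      _ = _ := by rw [← Real.rpow_add h0, sub_add_cancel]
  have ho : IsOpen {z : ℂ | a < z.re} := isOpen_lt continuous_const Complex.continuous_re
  have e1 : deriv (tailMellin fun t ↦ t * (psiErrLogTail t : ℂ)) =ᶠ[𝓝 s]
      tailMellin (fun t ↦ -(Real.log t : ℂ) * ((t : ℂ) * (psiErrLogTail t : ℂ))) := by
    filter_upwards [ho.mem_nhds has] with z hz
    exact (hasDerivAt_tailMellin (by fun_prop) b1 (ha1.trans hz)).deriv
  rw [e1.deriv_eq, (hasDerivAt_tailMellin (by fun_prop) b2 has).deriv]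
  refine setIntegral_congr_fun measurableSet_Ioi fun t (ht : 1 < t) ↦ ?_
  simp only [psiErrLogTail, psiErrHead]
  have hl : (Real.log t : ℂ) ≠ 0 := by exact_mod_cast (Real.log_pos ht).ne'
  have h0 : (t : ℂ) ≠ 0 := by exact_mod_cast (by linarith : t ≠ 0)
  split_ifs
  · push_cast
    field_simp
    ring
  · simp

lemma measurable_psiErrHead : Measurable psiErrHead :=
  Measurable.ite measurableSet_Ioi measurable_const measurable_psiErr

lemma measurable_ofReal_psiErrHead : Measurable fun t ↦ (psiErrHead t : ℂ) :=
  Complex.measurable_ofReal.comp measurable_psiErrHead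

lemma norm_psiErrHead_le (t : ℝ) (ht : t > 1) : ‖(psiErrHead t : ℂ)‖ ≤ 12 * t ^ (0 : ℝ) := by
  rw [psiErrHead, Complex.norm_real, Real.rpow_zero]
  split_ifs with h
  · simp
  · have := abs_psiErr_le (le_of_lt ht)
    rw [Real.norm_eq_abs]; linarith

lemma differentiableAt_tailMellin_psiErrHead {s : ℂ} (hs : 0 < s.re) :
    DifferentiableAt ℂ (tailMellin fun t ↦ (psiErrHead t : ℂ)) s :=
  (hasDerivAt_tailMellin measurable_ofReal_psiErrHead
    norm_psiErrHead_le hs).differentiableAt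

lemma landauRemainder_ode_of_one_lt {K : ℝ} (hB : ∀ x, 1 < x → 0 ≤ landauFun K x) {s : ℂ}
    (hs : 1 < s.re) :
    s * (deriv (deriv (landauRemainder K)) s + tailMellin (fun t ↦ (psiErrHead t : ℂ)) s) *
      regZeta s = -deriv regZeta s := by
  have ho : IsOpen {z : ℂ | 1 < z.re} := isOpen_lt continuous_const Complex.continuous_re
  have e1 : landauRemainder K =ᶠ[𝓝 s] tailMellin fun t ↦ t * (psiErrLogTail t : ℂ) := by
    filter_upwards [ho.mem_nhds hs] with z hz using landauRemainder_eq hB hz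
  have e2 : tailMellin (fun t ↦ (psiErr t : ℂ) - psiErrHead t) s =
      tailMellin (fun t ↦ (psiErr t : ℂ)) s - tailMellin (fun t ↦ (psiErrHead t : ℂ)) s := by
    rw [tailMellin, tailMellin, tailMellin, ← integral_sub
      (integrableOn_tailMellin measurable_ofReal_psiErr (fun t ht ↦ norm_psiErr_le ht) hs)
      (integrableOn_tailMellin measurable_ofReal_psiErrHead
        norm_psiErrHead_le (by linarith))]
    simp only [sub_mul]
  rw [e1.deriv.deriv_eq, deriv_deriv_tailMellin_psiErrLogTail hs, e2, tailMellin_psiErr hs]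
  have h1 : s ≠ 0 := by rintro rfl; norm_num at hs
  have h2 := regZeta_ne_zero_of_one_le_re hs.le
  field_simp
  ring

lemma isOpen_lt_re (T : ℝ) : IsOpen {s : ℂ | T < s.re} :=
  isOpen_lt continuous_const Complex.continuous_re

lemma convex_lt_re (T : ℝ) : Convex ℝ {s : ℂ | T < s.re} :=
  convex_halfSpace_re_gt T

open ProbabilityTheory in
lemma differentiableOn_landauTransform {K T : ℝ}
    (hI : Iio (-T) ⊆ integrableExpSet Real.log (landauMeasure K)) :
    DifferentiableOn ℂ (landauTransform K) {s : ℂ | T < s.re} := by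
  refine differentiableOn_complexMGF.comp (g := complexMGF Real.log (landauMeasure K))
    (f := fun s : ℂ ↦ -s) (by fun_prop) fun s (hs : T < s.re) ↦ ?_
  refine interior_mono hI ?_
  rw [isOpen_Iio.interior_eq]
  simpa using hs

lemma sub_half_ne_zero {s : ℂ} (hs : 1 / 2 < s.re) : s - 1 / 2 ≠ 0 := by
  intro h0; have := congrArg Complex.re h0; norm_num at this; linarith

open ProbabilityTheory in
lemma differentiableOn_landauRemainder {K T : ℝ} (hT : 1 / 2 ≤ T)
    (hI : Iio (-T) ⊆ integrableExpSet Real.log (landauMeasure K)) :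
    DifferentiableOn ℂ (landauRemainder K) {s : ℂ | T < s.re} := by
  have h := differentiableOn_landauTransform hI
  refine DifferentiableOn.sub (fun s hs ↦ ?_) (differentiableOn_id.mul h)
  have := sub_half_ne_zero (hT.trans_lt hs)
  exact DifferentiableAt.differentiableWithinAt (by fun_prop (disch := assumption))

lemma differentiableOn_tailMellin_psiErrHead {T : ℝ} (hT : 0 ≤ T) :
    DifferentiableOn ℂ (tailMellin fun t ↦ (psiErrHead t : ℂ)) {s : ℂ | T < s.re} :=
  fun _ hs ↦ (differentiableAt_tailMellin_psiErrHead (hT.trans_lt hs)).differentiableWithinAt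

lemma differentiable_deriv_regZeta : Differentiable ℂ (deriv regZeta) := by
  rw [← differentiableOn_univ]
  exact differentiable_regZeta.differentiableOn.deriv isOpen_univ

open ProbabilityTheory in
lemma landauRemainder_ode {K T : ℝ} (hB : ∀ x, 1 < x → 0 ≤ landauFun K x) (hT : 1 / 2 ≤ T)
    (hI : Iio (-T) ⊆ integrableExpSet Real.log (landauMeasure K)) {s : ℂ} (hs : T < s.re) :
    s * (deriv (deriv (landauRemainder K)) s + tailMellin (fun t ↦ (psiErrHead t : ℂ)) s) *
      regZeta s = -deriv regZeta s := by
  have ho := isOpen_lt_re T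
  have h1 := ((differentiableOn_landauRemainder hT hI).deriv ho).deriv ho
  have h2 := differentiableOn_tailMellin_psiErrHead (T := T) (by linarith)
  have hl : AnalyticOnNhd ℂ (fun s ↦ s * (deriv (deriv (landauRemainder K)) s +
      tailMellin (fun t ↦ (psiErrHead t : ℂ)) s) * regZeta s) {s : ℂ | T < s.re} :=
    DifferentiableOn.analyticOnNhd
      ((differentiableOn_id.mul (h1.add h2)).mul differentiable_regZeta.differentiableOn) ho
  have hr : AnalyticOnNhd ℂ (fun s ↦ -deriv regZeta s) {s : ℂ | T < s.re} :=
    differentiable_deriv_regZeta.neg.differentiableOn.analyticOnNhd ho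
  have hz : max T 1 + 1 ∈ {z : ℝ | T < z ∧ 1 < z} :=
    ⟨by linarith [le_max_left T 1], by linarith [le_max_right T 1]⟩
  refine hl.eqOn_of_preconnected_of_eventuallyEq hr (convex_lt_re T).isPreconnected
    (z₀ := ((max T 1 + 1 : ℝ) : ℂ)) (by simpa using hz.1) ?_ hs
  filter_upwards [(isOpen_lt_re 1).mem_nhds (x := ((max T 1 + 1 : ℝ) : ℂ)) (by simp)]
    with z hz using landauRemainder_ode_of_one_lt hB hz

lemma ae_log_nonneg_landauMeasure (K : ℝ) : 0 ≤ᵐ[landauMeasure K] Real.log := by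
  refine (withDensity_absolutelyContinuous _ _).ae_le ?_
  filter_upwards [ae_restrict_mem measurableSet_Ioi] with x hx
  exact Real.log_nonneg (le_of_lt hx)

open ProbabilityTheory in
lemma exists_Iio_subset_integrableExpSet {K T : ℝ} (hB : ∀ x, 1 < x → 0 ≤ landauFun K x)
    (hT : 1 / 2 < T) (hI : Iio (-T) ⊆ integrableExpSet Real.log (landauMeasure K)) :
    ∃ ε > 0, Iio (-T + ε) ⊆ integrableExpSet Real.log (landauMeasure K) := by
  have hev : ∀ᶠ z in 𝓝 (T : ℂ), regZeta z ≠ 0 ∧ 1 / 2 < z.re :=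
    (differentiable_regZeta.continuous.continuousAt.eventually_ne
      (regZeta_ofReal_ne_zero (by linarith))).and
      ((isOpen_lt_re (1 / 2)).mem_nhds (by simpa using hT))
  obtain ⟨ρ, hρ, hball⟩ := Metric.eventually_nhds_iff_ball.mp hev
  have ho := isOpen_lt_re T
  have hG := differentiableOn_landauRemainder hT.le hI
  have hne : ∀ z ∈ Metric.ball (T : ℂ) ρ, z ≠ 0 := by
    rintro z hz rfl
    have := (hball 0 hz).2
    norm_num at this
  have hh : DifferentiableOn ℂ (fun s ↦ -deriv regZeta s / (s * regZeta s) -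
      tailMellin (fun t ↦ (psiErrHead t : ℂ)) s) (Metric.ball (T : ℂ) ρ) := by
    refine DifferentiableOn.sub ?_ ((differentiableOn_tailMellin_psiErrHead (T := 1 / 2)
      (by norm_num)).mono fun z hz ↦ (hball z hz).2)
    exact differentiable_deriv_regZeta.neg.differentiableOn.div
      (differentiableOn_id.mul differentiable_regZeta.differentiableOn)
      fun z hz ↦ mul_ne_zero (hne z hz) (hball z hz).1
  obtain ⟨g₁, hg₁, hg₁e, -⟩ := exists_extension_of_deriv_eqOn ho (convex_lt_re T) (hG.deriv ho) hh
    fun z hz ↦ by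
      have := landauRemainder_ode hB hT.le hI hz.2
      have h1 := hne z hz.1
      have h2 := (hball z hz.1).1
      rw [← this]
      field_simp
      ring
  obtain ⟨g₂, hg₂, hg₂e, -⟩ := exists_extension_of_deriv_eqOn ho (convex_lt_re T) hG hg₁ hg₁e.symm
  have hF : DifferentiableOn ℂ (fun z ↦ (K * z / (z - 1 / 2) - g₂ z) / z)
      (Metric.ball (T : ℂ) ρ) := by
    refine (DifferentiableOn.sub (fun z hz ↦ ?_) hg₂).div differentiableOn_id hne
    have := sub_half_ne_zero (hball z hz).2
    exact DifferentiableAt.differentiableWithinAt (by fun_prop (disch := assumption))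
  have hFe : ∀ z ∈ Metric.ball (T : ℂ) ρ, T < z.re →
      (K * z / (z - 1 / 2) - g₂ z) / z = landauTransform K z := by
    intro z hz hzT
    rw [hg₂e ⟨hz, hzT⟩, landauRemainder, sub_sub_cancel, mul_div_cancel_left₀ _ (hne z hz)]
  have hmaps : MapsTo (fun z : ℂ ↦ -z) (Metric.ball ((-T - ρ / 4 : ℝ) : ℂ) (ρ / 2))
      (Metric.ball (T : ℂ) ρ) := by
    intro z hz
    rw [mem_ball_iff_norm] at hz ⊢
    have : -z - T = -(z - ((-T - ρ / 4 : ℝ) : ℂ)) + ((ρ / 4 : ℝ) : ℂ) := by push_cast; ring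
    rw [this]
    refine (norm_add_le _ _).trans_lt ?_
    rw [norm_neg, Complex.norm_real, Real.norm_of_nonneg (by linarith)]
    linarith
  have ht0 : -T - ρ / 4 < -T := by linarith
  have hint : -T - ρ / 4 ∈ interior (integrableExpSet Real.log (landauMeasure K)) :=
    interior_mono hI (by rw [isOpen_Iio.interior_eq]; exact ht0)
  have hmem := add_mem_integrableExpSet_of_differentiableOn (ae_log_nonneg_landauMeasure K) hint
    (hF.comp (f := fun z : ℂ ↦ -z) (by fun_prop) hmaps) (d := 3 / 8 * ρ) ?_ (by linarith)
    (by linarith)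
  · refine ⟨ρ / 8, by linarith, fun t (ht : t < -T + ρ / 8) ↦ ?_⟩
    rcases lt_or_ge t (-T) with h | h
    · exact hI h
    · exact convex_integrableExpSet.ordConnected.out (interior_subset hint) hmem
        ⟨by linarith, by linarith⟩
  · filter_upwards [Metric.isOpen_ball.mem_nhds (Metric.mem_ball_self (x := ((-T - ρ / 4 : ℝ) : ℂ))
      (by linarith : 0 < ρ / 4))] with z hz
    have h1 := hFe (-z) (hmaps (Metric.ball_subset_ball (by linarith) hz)) ?_
    · simp only [Function.comp_apply]
      rw [h1, landauTransform, neg_neg]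
    · rw [mem_ball_iff_norm] at hz
      have := (Complex.abs_re_le_norm _).trans_lt hz
      have := (abs_lt.mp this).2
      simp at this ⊢
      linarith

open ProbabilityTheory in
lemma Iio_neg_half_subset_integrableExpSet {K : ℝ} (hB : ∀ x, 1 < x → 0 ≤ landauFun K x)
    (hK : 0 ≤ K) : Iio (-(1 / 2)) ⊆ integrableExpSet Real.log (landauMeasure K) := by
  set S := {T : ℝ | 1 / 2 ≤ T ∧ Iio (-T) ⊆ integrableExpSet Real.log (landauMeasure K)} with hS
  have h1 : (1 : ℝ) ∈ S :=
    ⟨by norm_num, fun t ht ↦ mem_integrableExpSet_landauMeasure hB hK ht⟩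
  have hbdd : BddBelow S := ⟨1 / 2, fun T hT ↦ hT.1⟩
  have hT0 : 1 / 2 ≤ sInf S := le_csInf ⟨1, h1⟩ fun T hT ↦ hT.1
  have hI : Iio (-sInf S) ⊆ integrableExpSet Real.log (landauMeasure K) := by
    intro t (ht : t < -sInf S)
    obtain ⟨T, hT, hTt⟩ := exists_lt_of_csInf_lt ⟨1, h1⟩ (show sInf S < -t by linarith)
    exact hT.2 (show t < -T by linarith)
  rcases hT0.eq_or_lt with h | h
  · rwa [← h] at hI
  · obtain ⟨ε, hε, hεI⟩ := exists_Iio_subset_integrableExpSet hB h hI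
    have hmem : max (1 / 2) (sInf S - ε) ∈ S := by
      refine ⟨le_max_left _ _, fun t (ht : t < _) ↦ hεI ?_⟩
      have := le_max_right (1 / 2) (sInf S - ε)
      exact mem_Iio.mpr (by linarith)
    have := csInf_le hbdd hmem
    rcases le_max_iff.mp this with h' | h' <;> linarith

lemma regZeta_ne_zero_of_landauFun_nonneg {K : ℝ} (hB : ∀ x, 1 < x → 0 ≤ landauFun K x)
    (hK : 0 ≤ K) {s : ℂ} (hs : 1 / 2 < s.re) : regZeta s ≠ 0 := by
  intro h0
  have hI := Iio_neg_half_subset_integrableExpSet hB hK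
  have ho := isOpen_lt_re (1 / 2)
  have hd := ((differentiableOn_landauRemainder le_rfl hI).deriv ho).deriv ho
  have hq := differentiableOn_tailMellin_psiErrHead (T := 1 / 2) (by norm_num)
  have hh : AnalyticAt ℂ (fun s ↦ -(s * (deriv (deriv (landauRemainder K)) s +
      tailMellin (fun t ↦ (psiErrHead t : ℂ)) s))) s :=
    ((differentiableOn_id.mul (hd.add hq)).neg.analyticOnNhd ho) s hs
  have hZ : AnalyticAt ℂ regZeta s := differentiable_regZeta.analyticAt s
  have heq : deriv regZeta =ᶠ[𝓝 s] (fun s ↦ -(s * (deriv (deriv (landauRemainder K)) s +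
      tailMellin (fun t ↦ (psiErrHead t : ℂ)) s))) * regZeta := by
    filter_upwards [ho.mem_nhds hs] with z hz
    have := landauRemainder_ode hB le_rfl hI hz
    simp only [Pi.mul_apply]
    linear_combination this
  have hord := hZ.analyticOrderAt_deriv_add_one
  rw [h0, analyticOrderAt_congr heq, analyticOrderAt_mul hh hZ] at hord
  simp only [sub_zero] at hord
  have hfin : analyticOrderAt regZeta s ≠ ⊤ := by
    intro htop
    rw [analyticOrderAt_eq_top] at htop
    have : AnalyticOnNhd ℂ regZeta univ := fun z _ ↦ differentiable_regZeta.analyticAt z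
    have := this.eqOn_zero_of_preconnected_of_eventuallyEq_zero isPreconnected_univ (mem_univ s)
      htop (mem_univ 1)
    rw [regZeta_one] at this
    simp at this
  generalize analyticOrderAt regZeta s = n at *
  generalize analyticOrderAt (_ : ℂ → ℂ) s = m at *
  lift n to ℕ using hfin
  cases m with
  | top => simp at hord
  | coe m => norm_cast at hord; omega

lemma exists_landauFun_nonneg
    (h : ∀ᶠ x : ℝ in atTop, 0 < Li (Chebyshev.psi x) - Nat.primeCounting ⌊x⌋₊) :
    ∃ K, 0 ≤ K ∧ ∀ x, 1 < x → 0 ≤ landauFun K x := by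
  obtain ⟨C, hC0, hC⟩ := exists_Li_psi_sub_le
  obtain ⟨X, hX⟩ := eventually_atTop.mp (h.and hC)
  refine ⟨C + 14 * |X|, by positivity, fun x hx ↦ ?_⟩
  have hsx : 1 ≤ √x := Real.one_le_sqrt.mpr hx.le
  have hXs : 0 ≤ 14 * |X| * √x := by positivity
  have hCs : 0 ≤ C * √x := by positivity
  rw [landauFun, add_mul]
  rcases le_total x 2 with h2 | h2
  · rw [psiErrLogTailInt_eq_zero hx.le h2]
    linarith
  · rcases le_total X x with hXx | hXx
    · have := hX x hXx
      rw [psiErrLogTailInt_eq h2]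
      linarith
    · have h3 := (abs_le.mp (abs_psiErrLogTailInt_le hx.le)).2
      have h4 := le_abs_self X
      nlinarith

lemma regZeta_ne_zero_of_riemannHypothesis
    (h : ∀ ρ : ℂ, riemannZeta ρ = 0 → 0 < ρ.re → ρ.re < 1 → ρ.re = 1 / 2) {s : ℂ}
    (hs : 1 / 2 < s.re) : regZeta s ≠ 0 := by
  rcases le_or_gt 1 s.re with h1 | h1
  · exact regZeta_ne_zero_of_one_le_re h1
  · have hs1 : s ≠ 1 := by rintro rfl; simp at h1
    rw [regZeta_of_ne hs1]
    exact mul_ne_zero (sub_ne_zero.mpr hs1) fun h0 ↦ hs.ne' (h s h0 (by linarith) h1)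

lemma riemannHypothesis_of_regZeta_ne_zero (h : ∀ s : ℂ, 1 / 2 < s.re → regZeta s ≠ 0) {ρ : ℂ}
    (hρ : riemannZeta ρ = 0) (h0 : 0 < ρ.re) (h1 : ρ.re < 1) : ρ.re = 1 / 2 := by
  have hle : ∀ s : ℂ, riemannZeta s = 0 → s.re < 1 → s.re ≤ 1 / 2 := by
    intro s hs hs1
    by_contra! hlt
    refine h s hlt ?_
    rw [regZeta_of_ne (by rintro rfl; simp at hs1), hs, mul_zero]
  have hsymm : riemannZeta (1 - ρ) = 0 := by
    rw [riemannZeta_one_sub (fun n hn ↦ ?_) (by rintro rfl; simp at h1), hρ, mul_zero]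
    have := congrArg Complex.re hn
    simp at this
    have : (0 : ℝ) ≤ n := n.cast_nonneg
    linarith
  have := hle ρ hρ h1
  have := hle (1 - ρ) hsymm (by simpa using h0)
  simp at this
  linarith

end

/-- RH holds iff Li(ψ(x)) − π(x) > 0 for all sufficiently large x. -/
theorem riemannHypothesis_iff_eventually_li_psi_sub_pi_pos :
    (∀ ρ : ℂ, riemannZeta ρ = 0 → 0 < ρ.re → ρ.re < 1 → ρ.re = 1 / 2) ↔
    ∀ᶠ x : ℝ in atTop, 0 < Li (chebyshevPsi x) - primePi x := by
  refine ⟨fun h ↦ ?_, fun h ρ hρ h0 h1 ↦ ?_⟩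
  · exact eventually_Li_psi_sub_pos_of_isLittleO fun ε hε ↦
      eventually_abs_psiErrInt_le (fun s hs ↦ regZeta_ne_zero_of_riemannHypothesis h hs) hε
  · obtain ⟨K, hK, hB⟩ := exists_landauFun_nonneg h
    exact riemannHypothesis_of_regZeta_ne_zero
      (fun s hs ↦ regZeta_ne_zero_of_landauFun_nonneg hB hK hs) hρ h0 h1
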